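/- arXiv:1304.3922 — 2 statements merged into one kernel-verified Lean document; each statement's English description precedes it below -/
import Mathlib

section
/- Let k be a positive even integer and z an appropriate algebraic irrational. Then (1+z)^{k−1} ψ_k(z/(1+z)) − (1−z)^{k−1} ψ_k(z/(1−z)) = ((πi)^k / k!) ∑_{m=0}^{k} (2^{m−1} − 1) B_m E_{k−m} C(k,m) [(1+z)^{m−1} − (1−z)^{m−1}]. -/
open Real Complex

/-- The Euler numbers `E_m`, defined by `E_0 = 1`, `E_m = 0` for odd `m`, and the
recurrence `∑_{k=0}^{n} C(2n, 2k) E_{2k} = 0` for `n ≥ 1`; these are the Taylor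
coefficients of the secant: `sec(πx) = ∑ E_m (πix)^m / m!`. -/
def eulerNumber : ℕ → ℚ
  | 0 => 1
  | (n + 1) =>
    if (n + 1) % 2 = 1 then 0
    else -∑ k ∈ (Finset.range ((n + 1) / 2)).attach,
      ((n + 1).choose (2 * k.1) : ℚ) * eulerNumber (2 * k.1)
  decreasing_by
    have := k.2
    simp only [Finset.mem_range] at this
    omega


open Metric in
lemma szm_J (R : ℝ) (hR : 0 < R) (a : ℂ) (ha : a ∈ ball (0:ℂ) R) (ha0 : a ≠ 0) (k : ℕ) :
    (∮ w in C(0, R), (1 / w ^ (k + 1)) * (1 / (w - a))) = 0 := by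
  have hne0 : ∀ w ∈ sphere (0:ℂ) R, w ≠ 0 := by
    rintro w hw rfl
    simp at hw; linarith
  have hnea : ∀ w ∈ sphere (0:ℂ) R, w - a ≠ 0 := by
    intro w hw h
    rw [sub_eq_zero] at h
    subst h
    simp at hw ha; linarith
  have hci : ∀ m : ℕ, CircleIntegrable (fun w : ℂ => (1 / w ^ m) * (1 / (w - a))) 0 R := by
    intro m
    apply ContinuousOn.circleIntegrable hR.le
    apply ContinuousOn.mul
    · exact ContinuousOn.div continuousOn_const (by fun_prop) (fun w hw => pow_ne_zero _ (hne0 w hw))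
    · exact ContinuousOn.div continuousOn_const (by fun_prop) (fun w hw => hnea w hw)
  have hci2 : ∀ m : ℕ, CircleIntegrable (fun w : ℂ => (1 / w ^ m)) 0 R := by
    intro m
    apply ContinuousOn.circleIntegrable hR.le
    exact ContinuousOn.div continuousOn_const (by fun_prop) (fun w hw => pow_ne_zero _ (hne0 w hw))
  have hrec : ∀ m : ℕ, (∮ w in C(0, R), (1 / w ^ (m + 1)) * (1 / (w - a))) =
      a⁻¹ * ((∮ w in C(0, R), (1 / w ^ m) * (1 / (w - a))) - ∮ w in C(0, R), 1 / w ^ (m + 1)) := by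
    intro m
    rw [← circleIntegral.integral_sub (hci m) (hci2 (m+1)), ← circleIntegral.integral_const_mul]
    apply circleIntegral.integral_congr hR.le
    intro w hw
    have h1 := hne0 w hw
    have h2 := hnea w hw
    simp only
    field_simp
    ring
  induction k with
  | zero =>
    rw [hrec 0]
    have h1 := circleIntegral.integral_sub_inv_of_mem_ball ha
    have h2 := circleIntegral.integral_sub_center_inv (0:ℂ) hR.ne'
    simp at h1 h2
    simp [h1, h2]
  | succ k ih =>
    rw [hrec (k+1), ih]
    have h1 := circleIntegral.integral_sub_zpow_of_ne (n := -((k:ℤ)+2)) (by omega) 0 0 R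
    have : (∮ w in C((0:ℂ), R), 1 / w ^ (k + 1 + 1)) = 0 := by
      refine Eq.trans (circleIntegral.integral_congr hR.le ?_) h1
      intro w hw
      simp only [sub_zero]
      rw [zpow_neg, one_div]
      norm_cast
    rw [this]; simp

lemma szm_iter (a : ℂ) (k : ℕ) (ha0 : a ≠ 0) :
    iteratedDeriv k (fun w : ℂ => 1 / (w - a)) 0 = - (k.factorial : ℂ) / a ^ (k + 1) := by
  have := iter_deriv_inv_linear_sub k (1:ℂ) a
  rw [iteratedDeriv_eq_iterate]
  simp only [one_mul, one_pow, mul_one] at this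
  simp only [one_div]
  rw [this]
  simp only [zero_sub]
  rw [show (-1 - (k:ℤ)) = -((k + 1 : ℕ) : ℤ) by push_cast; ring, zpow_neg, zpow_natCast, neg_pow a]
  have h : ((-1:ℂ))^k * (-1)^k = 1 := by rw [← mul_pow]; simp
  have h2 : ((-1:ℂ))^k ≠ 0 := by simp
  rw [pow_succ (-1 : ℂ)]
  field_simp

open Metric in
lemma szm_residue (R : ℝ) (hR : 0 < R) (k : ℕ) (s : Finset ℂ) : ∀ (N D : ℂ → ℂ),
    Differentiable ℂ N → Differentiable ℂ D →
    (∀ w ∈ closedBall (0:ℂ) R, (D w = 0 ↔ w ∈ s)) →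
    (∀ a ∈ s, a ∈ ball (0:ℂ) R ∧ a ≠ 0 ∧ deriv D a ≠ 0) →
    (∮ w in C(0, R), (1 / w ^ (k + 1)) * (N w / D w)) =
      2 * π * I * (iteratedDeriv k (fun w => N w / D w) 0 / k.factorial
        + ∑ a ∈ s, N a / deriv D a / a ^ (k + 1)) := by
  induction s using Finset.induction_on with
  | empty =>
    intro N D hN hD hz _
    have hd : DiffContOnCl ℂ (fun w => N w / D w) (ball (0:ℂ) R) := by
      apply DifferentiableOn.diffContOnCl
      rw [closure_ball _ hR.ne']
      apply DifferentiableOn.div hN.differentiableOn hD.differentiableOn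
      intro w hw h
      simpa using (hz w hw).1 h
    have := hd.circleIntegral_one_div_sub_center_pow_smul hR k
    simp only [sub_zero, smul_eq_mul] at this
    rw [this]
    simp
    ring
  | insert a s has ih =>
    intro N D hN hD hz hs
    obtain ⟨haR, ha0, haD⟩ := hs a (by simp)
    have haR' : a ∈ closedBall (0:ℂ) R := ball_subset_closedBall haR
    have hDa : D a = 0 := (hz a haR').2 (by simp)
    have hds : ∀ f : ℂ → ℂ, Differentiable ℂ f → Differentiable ℂ (dslope f a) := by
      intro f hf
      rw [← differentiableOn_univ]
      exact (Complex.differentiableOn_dslope Filter.univ_mem).2 hf.differentiableOn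
    set D1 := dslope D a with hD1
    have hD1d : Differentiable ℂ D1 := hds D hD
    have hD1a : D1 a = deriv D a := dslope_same _ _
    have hDD1 : ∀ w, D w = (w - a) * D1 w := by
      intro w
      have := sub_smul_dslope D a w
      rw [hDa, sub_zero, smul_eq_mul] at this
      exact this.symm
    set c := N a / deriv D a with hc
    set M : ℂ → ℂ := fun w => N w - c * D1 w with hM
    have hMd : Differentiable ℂ M := hN.sub (hD1d.const_mul c)
    have hMa : M a = 0 := by
      simp only [hM, hD1a, hc]; field_simp; simp
    set N1 := dslope M a with hN1
    have hN1d : Differentiable ℂ N1 := hds M hMd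
    have hMN1 : ∀ w, M w = (w - a) * N1 w := by
      intro w
      have := sub_smul_dslope M a w
      rw [hMa, sub_zero, smul_eq_mul] at this
      exact this.symm
    have hsa : ∀ b ∈ s, b ≠ a := by
      rintro b hb rfl; exact has hb
    have hz1 : ∀ w ∈ closedBall (0:ℂ) R, (D1 w = 0 ↔ w ∈ s) := by
      intro w hw
      by_cases hwa : w = a
      · subst hwa
        simp [hD1a, haD, has]
      · have := hz w hw
        rw [hDD1 w] at this
        simpa [sub_eq_zero, hwa] using this
    have hder : ∀ b ∈ s, deriv D b = (b - a) * deriv D1 b := by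
      intro b hb
      have hb0 : D1 b = 0 := (hz1 b (ball_subset_closedBall (hs b (by simp [hb])).1)).2 hb
      have h1 : HasDerivAt (fun w => (w - a) * D1 w) (1 * D1 b + (b - a) * deriv D1 b) b :=
        ((hasDerivAt_id b).sub_const a).mul (hD1d b).hasDerivAt
      have h2 : D = (fun w => (w - a) * D1 w) := funext hDD1
      rw [h2, h1.deriv, hb0]; simp
    have hs1 : ∀ b ∈ s, b ∈ ball (0:ℂ) R ∧ b ≠ 0 ∧ deriv D1 b ≠ 0 := by
      intro b hb
      obtain ⟨h1, h2, h3⟩ := hs b (by simp [hb])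
      refine ⟨h1, h2, ?_⟩
      intro h
      apply h3
      rw [hder b hb, h, mul_zero]
    have hih := ih N1 D1 hN1d hD1d hz1 hs1
    have hdec : ∀ w, w ≠ a → D1 w ≠ 0 → N w / D w = c * (1 / (w - a)) + N1 w / D1 w := by
      intro w hw h1
      have h2 : w - a ≠ 0 := sub_ne_zero.2 hw
      have h3 : N w = (w - a) * N1 w + c * D1 w := by
        rw [← hMN1 w]; simp [hM]
      rw [hDD1 w, h3]
      field_simp
      ring
    have hsum : ∑ b ∈ s, N1 b / deriv D1 b / b ^ (k + 1) = ∑ b ∈ s, N b / deriv D b / b ^ (k + 1) := by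
      apply Finset.sum_congr rfl
      intro b hb
      have h2 : b - a ≠ 0 := sub_ne_zero.2 (hsa b hb)
      have hb0 : D1 b = 0 := (hz1 b (ball_subset_closedBall (hs b (by simp [hb])).1)).2 hb
      have h3 : N b = (b - a) * N1 b := by
        rw [← hMN1 b]; simp [hM, hb0]
      obtain ⟨_, h5, h4⟩ := hs1 b hb
      rw [hder b hb, h3]
      field_simp
    rw [hsum] at hih
    have hnsph : ∀ w ∈ sphere (0:ℂ) R, w ≠ 0 ∧ w - a ≠ 0 ∧ D1 w ≠ 0 := by
      intro w hw
      refine ⟨?_, ?_, ?_⟩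
      · rintro rfl
        simp at hw; linarith
      · intro h
        rw [sub_eq_zero] at h
        subst h
        simp at hw haR; linarith
      · intro h
        have h1 := (hz1 w (sphere_subset_closedBall hw)).1 h
        have h2 := (hs1 w h1).1
        simp at hw h2; linarith
    have hcirc : (∮ w in C(0, R), (1 / w ^ (k + 1)) * (N w / D w)) =
        c * (∮ w in C(0, R), (1 / w ^ (k + 1)) * (1 / (w - a))) +
        (∮ w in C(0, R), (1 / w ^ (k + 1)) * (N1 w / D1 w)) := by
      rw [← circleIntegral.integral_const_mul, ← circleIntegral.integral_add]
      · apply circleIntegral.integral_congr hR.le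
        intro w hw
        obtain ⟨h1, h2, h3⟩ := hnsph w hw
        simp only
        rw [hdec w (sub_ne_zero.1 h2) h3]
        ring
      · apply ContinuousOn.circleIntegrable hR.le
        apply ContinuousOn.mul continuousOn_const
        apply ContinuousOn.mul
        · exact ContinuousOn.div continuousOn_const (by fun_prop)
            (fun w hw => pow_ne_zero _ (hnsph w hw).1)
        · exact ContinuousOn.div continuousOn_const (by fun_prop) (fun w hw => (hnsph w hw).2.1)
      · apply ContinuousOn.circleIntegrable hR.le
        apply ContinuousOn.mul
        · exact ContinuousOn.div continuousOn_const (by fun_prop)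
            (fun w hw => pow_ne_zero _ (hnsph w hw).1)
        · exact ContinuousOn.div hN1d.continuous.continuousOn hD1d.continuous.continuousOn
            (fun w hw => (hnsph w hw).2.2)
    have hD10 : D1 0 ≠ 0 := by
      intro h
      have h1 := (hz1 0 (by simp [hR.le])).1 h
      exact (hs1 0 h1).2.1 rfl
    have hit : iteratedDeriv k (fun w => N w / D w) 0 =
        c * (- (k.factorial : ℂ) / a ^ (k + 1)) + iteratedDeriv k (fun w => N1 w / D1 w) 0 := by
      have hev : (fun w => N w / D w) =ᶠ[nhds 0]
          (fun w => c * (1 / (w - a)) + N1 w / D1 w) := by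
        filter_upwards [hD1d.continuous.continuousAt.eventually_ne hD10,
          isOpen_ne.mem_nhds ha0.symm] with w h1 h2
        exact hdec w h2 h1
      rw [hev.iteratedDeriv_eq]
      have hca1 : ContDiffAt ℂ k (fun w : ℂ => 1 / (w - a)) 0 := by
        apply ContDiffAt.div contDiffAt_const (by fun_prop)
        simpa using ha0
      have hca2 : ContDiffAt ℂ k (fun w : ℂ => N1 w / D1 w) 0 :=
        ContDiffAt.div (hN1d.contDiff.contDiffAt) (hD1d.contDiff.contDiffAt) hD10
      rw [iteratedDeriv_fun_add (contDiffAt_const.mul hca1) hca2, iteratedDeriv_const_mul_field,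
        szm_iter a k ha0]
    rw [hcirc, hih, szm_J R hR a haR ha0 k, hit, Finset.sum_insert has]
    have : (k.factorial : ℂ) ≠ 0 := by exact_mod_cast k.factorial_ne_zero
    rw [← hc]
    field_simp
    ring

lemma szm_normsq (v : ℂ) : ‖Complex.sin v‖ ^ 2 = Real.sin v.re ^ 2 + Real.sinh v.im ^ 2 := by
  rw [← Complex.normSq_eq_norm_sq, Complex.sin_eq, ← Complex.ofReal_sin, ← Complex.ofReal_cos,
    ← Complex.ofReal_cosh, ← Complex.ofReal_sinh, ← Complex.ofReal_mul, ← Complex.ofReal_mul,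
    Complex.normSq_add_mul_I]
  rw [mul_pow, mul_pow, Real.cosh_sq, Real.cos_sq']
  ring

lemma szm_sin_lower (u : ℂ) (δ : ℝ) (hδ : 0 < δ) (h : ∀ n : ℤ, δ ≤ ‖u - n * π‖) :
    Real.cosh u.im ≤ √(1 + π ^ 2 / (4 * δ ^ 2)) * ‖Complex.sin u‖ := by
  set n : ℤ := round (u.re / π) with hn
  set v : ℂ := u - n * π with hv
  have hvim : v.im = u.im := by simp [hv]
  have hvre : v.re = u.re - n * π := by simp [hv]
  have hpi := Real.pi_pos
  have hre : |v.re| ≤ π / 2 := by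
    have h1 := abs_sub_round (u.re / π)
    rw [← hn] at h1
    have : v.re = (u.re / π - n) * π := by rw [hvre]; field_simp
    rw [this, abs_mul, abs_of_pos hpi]
    nlinarith
  have hsin : ‖Complex.sin u‖ = ‖Complex.sin v‖ := by
    rw [hv, Complex.sin_antiperiodic.sub_int_mul_eq]
    rcases Int.even_or_odd n with hh | hh <;> simp [Int.negOnePow_even, Int.negOnePow_odd, hh]
  have hnorm : ‖Complex.sin v‖ ^ 2 = Real.sin v.re ^ 2 + Real.sinh u.im ^ 2 := by
    rw [szm_normsq, hvim]
  have hvn : δ ^ 2 ≤ v.re ^ 2 + u.im ^ 2 := by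
    have h1 := h n
    rw [← hv] at h1
    have h2 : ‖v‖ ^ 2 = v.re ^ 2 + u.im ^ 2 := by
      rw [← Complex.normSq_eq_norm_sq, Complex.normSq_apply, hvim]; ring
    rw [← h2]
    gcongr
  have h4 : 4 / π ^ 2 * v.re ^ 2 ≤ Real.sin v.re ^ 2 := by
    have := Real.mul_abs_le_abs_sin hre
    have h5 : (2 / π * |v.re|) ^ 2 ≤ |Real.sin v.re| ^ 2 := by gcongr
    rw [mul_pow, sq_abs, sq_abs, div_pow] at h5
    norm_num at h5 ⊢
    exact h5
  have h6 : u.im ^ 2 ≤ Real.sinh u.im ^ 2 := by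
    have h7 : |u.im| ≤ Real.sinh |u.im| := Real.self_le_sinh_iff.2 (abs_nonneg _)
    have h8 : Real.sinh |u.im| ^ 2 = Real.sinh u.im ^ 2 := by
      rcases abs_choice u.im with h | h <;> rw [h] <;> simp [Real.sinh_neg]
    rw [← h8, ← sq_abs u.im]
    gcongr
  set T := ‖Complex.sin v‖ ^ 2 with hT
  have h9 : 4 / π ^ 2 * δ ^ 2 ≤ T := by
    rw [hnorm]
    have h10 : 4 / π ^ 2 ≤ 1 := by
      rw [div_le_one (by positivity)]
      nlinarith [Real.pi_gt_three]
    have h11 : 4 / π ^ 2 * u.im ^ 2 ≤ u.im ^ 2 := by nlinarith [sq_nonneg u.im]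
    have h12 : 4 / π ^ 2 * δ ^ 2 ≤ 4 / π ^ 2 * (v.re ^ 2 + u.im ^ 2) := by gcongr
    linarith
  have h13 : 1 ≤ π ^ 2 / (4 * δ ^ 2) * T := by
    calc 1 = π ^ 2 / (4 * δ ^ 2) * (4 / π ^ 2 * δ ^ 2) := by field_simp
      _ ≤ _ := by gcongr
  have h14 : Real.cosh u.im ^ 2 ≤ (1 + π ^ 2 / (4 * δ ^ 2)) * T := by
    rw [Real.cosh_sq]
    have : Real.sinh u.im ^ 2 ≤ T := by rw [hnorm]; nlinarith [sq_nonneg (Real.sin v.re)]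
    linarith
  rw [hsin]
  rw [← sq_le_sq₀ (Real.cosh_pos _).le (by positivity)]
  rw [mul_pow, Real.sq_sqrt (by positivity)]
  exact h14

lemma szm_sin_upper (u : ℂ) : ‖Complex.sin u‖ ≤ Real.cosh u.im := by
  have hnorm := szm_normsq u
  rw [← sq_le_sq₀ (by positivity) (Real.cosh_pos _).le]
  rw [hnorm, Real.cosh_sq]
  nlinarith [Real.sin_sq_add_cos_sq u.re, sq_nonneg (Real.cos u.re)]

lemma szm_cosh (z y : ℝ) :
    Real.cosh (z * y) ≤ Real.cosh ((1 + z) * y) * Real.cosh ((1 - z) * y) := by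
  have h1 : Real.cosh ((1 + z) * y) = Real.cosh y * Real.cosh (z * y) + Real.sinh y * Real.sinh (z * y) := by
    rw [← Real.cosh_add]; ring_nf
  have h2 : Real.cosh ((1 - z) * y) = Real.cosh y * Real.cosh (z * y) - Real.sinh y * Real.sinh (z * y) := by
    rw [← Real.cosh_sub]; ring_nf
  rw [h1, h2]
  have h3 := Real.cosh_sq y
  have h4 := Real.cosh_sq (z * y)
  have h5 := Real.one_le_cosh (z * y)
  nlinarith [sq_nonneg (Real.sinh y)]

/-- avoiding radii -/
lemma szm_radius_aux (α β : ℝ) (hβ : 0 < β) (hab : β ≤ α) :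
    ∃ δ > 0, ∀ X : ℝ, ∃ R ≥ X, ∀ n : ℤ, δ ≤ |α * R - n| ∧ δ ≤ |β * R - n| := by
  have hα : 0 < α := by linarith
  refine ⟨β / α / 8, by positivity, fun X => ?_⟩
  set r := β / α with hr
  have hr0 : 0 < r := by positivity
  have hr1 : r ≤ 1 := by rw [hr, div_le_one hα]; exact hab
  set N : ℤ := ⌈α * X⌉ with hN
  have hNX : α * X ≤ N := Int.le_ceil _
  have hfin : ∀ t : ℝ, (N:ℝ) ≤ t → X ≤ t / α := by
    intro t ht
    rw [le_div_iff₀ hα]; linarith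
  have hfr : ∀ t : ℝ, N + 1 / 4 ≤ t → t ≤ N + 1 / 2 → ∀ n : ℤ, r / 8 ≤ |t - n| := by
    intro t h1 h2 n
    rcases le_or_gt n N with h | h
    · have : (n:ℝ) ≤ N := by exact_mod_cast h
      rw [abs_of_nonneg] <;> linarith
    · have : (N:ℝ) + 1 ≤ n := by exact_mod_cast h
      rw [abs_of_nonpos] <;> linarith
  have e1 : ∀ t : ℝ, α * (t / α) = t := by intro t; field_simp
  have e2 : ∀ t : ℝ, β * (t / α) = r * t := by intro t; rw [hr]; ring
  by_cases hc : ∀ n : ℤ, r / 8 ≤ |r * (N + 1 / 4) - n|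
  · refine ⟨(N + 1 / 4) / α, hfin _ (by linarith), fun n => ?_⟩
    rw [e1, e2]
    exact ⟨hfr _ (by linarith) (by linarith) n, hc n⟩
  · push Not at hc
    obtain ⟨m, hm⟩ := hc
    refine ⟨(N + 1 / 2) / α, hfin _ (by linarith), fun n => ?_⟩
    rw [e1, e2]
    refine ⟨hfr _ (by linarith) (by linarith) n, ?_⟩
    rw [abs_lt] at hm
    rcases le_or_gt n m with h | h
    · have : (n:ℝ) ≤ m := by exact_mod_cast h
      rw [abs_of_nonneg] <;> linarith
    · have : (m:ℝ) + 1 ≤ n := by exact_mod_cast h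
      rw [abs_of_nonpos] <;> linarith

lemma szm_radius (α β : ℝ) (hα : 0 < α) (hβ : 0 < β) :
    ∃ δ > 0, ∀ X : ℝ, ∃ R ≥ X, ∀ n : ℤ, δ ≤ |α * R - n| ∧ δ ≤ |β * R - n| := by
  rcases le_total β α with h | h
  · exact szm_radius_aux α β hβ h
  · obtain ⟨δ, h1, h2⟩ := szm_radius_aux β α hα h
    refine ⟨δ, h1, fun X => ?_⟩
    obtain ⟨R, h3, h4⟩ := h2 X
    exact ⟨R, h3, fun n => (h4 n).symm⟩

lemma szm_dist (p R δ : ℝ) (h : ∀ n : ℤ, δ ≤ |(|p| * R) - n|) (hR : 0 ≤ R) (w : ℂ) (hw : ‖w‖ = R)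
    (n : ℤ) : π * δ ≤ ‖(π * p * w : ℂ) - n * π‖ := by
  have h1 : (π * p * w : ℂ) - n * π = π * (p * w - n) := by ring
  rw [h1, norm_mul, Complex.norm_real, Real.norm_of_nonneg Real.pi_pos.le]
  gcongr
  refine (h |n|).trans ?_
  have h2 := abs_norm_sub_norm_le (p * w : ℂ) (n : ℂ)
  rw [norm_mul, Complex.norm_real, hw, Complex.norm_intCast, Real.norm_eq_abs] at h2
  push_cast
  exact h2

lemma szm_bound (z R δ : ℝ) (hδ : 0 < δ) (hR : 0 ≤ R)
    (h1 : ∀ n : ℤ, δ ≤ |(|1 + z| * R) - n|) (h2 : ∀ n : ℤ, δ ≤ |(|1 - z| * R) - n|)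
    (w : ℂ) (hw : ‖w‖ = R) :
    ‖Complex.sin (π * z * w)‖ ≤ (1 + π ^ 2 / (4 * (π * δ) ^ 2)) *
      (‖Complex.sin (π * (1 + z : ℝ) * w)‖ * ‖Complex.sin (π * (1 - z : ℝ) * w)‖) := by
  have hpd : 0 < π * δ := by positivity
  have a1 := szm_sin_lower (π * (1 + z : ℝ) * w) (π * δ) hpd (szm_dist _ R δ h1 hR w hw)
  have a2 := szm_sin_lower (π * (1 - z : ℝ) * w) (π * δ) hpd (szm_dist _ R δ h2 hR w hw)
  have a3 := szm_sin_upper (π * z * w)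
  have a4 := szm_cosh z (π * w.im)
  have i1 : ∀ c : ℝ, (π * c * w : ℂ).im = c * (π * w.im) := by
    intro c
    rw [← Complex.ofReal_mul, Complex.im_ofReal_mul]; ring
  rw [i1] at a1 a2 a3
  set K := 1 + π ^ 2 / (4 * (π * δ) ^ 2) with hK
  have hK0 : 0 ≤ K := by positivity
  calc _ ≤ _ := a3
    _ ≤ _ := a4
    _ ≤ (√K * ‖Complex.sin (π * (1 + z : ℝ) * w)‖) * (√K * ‖Complex.sin (π * (1 - z : ℝ) * w)‖) := by
      have := Real.cosh_pos ((1 + z) * (π * w.im))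
      have := Real.cosh_pos ((1 - z) * (π * w.im))
      gcongr
    _ = (√K * √K) * (‖Complex.sin (π * (1 + z : ℝ) * w)‖ * ‖Complex.sin (π * (1 - z : ℝ) * w)‖) := by ring
    _ = _ := by rw [Real.mul_self_sqrt hK0]

noncomputable def szmT (f : ℂ → ℂ) : PowerSeries ℂ :=
  PowerSeries.mk fun n => iteratedDeriv n f 0 / (n.factorial : ℂ)

lemma szmT_mul (f g : ℂ → ℂ) (hf : AnalyticAt ℂ f 0) (hg : AnalyticAt ℂ g 0) :
    szmT (fun w => f w * g w) = szmT f * szmT g := by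
  ext n
  rw [PowerSeries.coeff_mul, Finset.Nat.sum_antidiagonal_eq_sum_range_succ_mk]
  simp only [szmT, PowerSeries.coeff_mk]
  rw [iteratedDeriv_fun_mul hf.contDiffAt hg.contDiffAt, Finset.sum_div]
  apply Finset.sum_congr rfl
  intro i hi
  have hi' : i ≤ n := by simp at hi; omega
  have h1 : (i.factorial : ℂ) ≠ 0 := by exact_mod_cast i.factorial_ne_zero
  have h2 : ((n - i).factorial : ℂ) ≠ 0 := by exact_mod_cast (n - i).factorial_ne_zero
  have h3 : (n.factorial : ℂ) ≠ 0 := by exact_mod_cast n.factorial_ne_zero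
  have h4 : (n.choose i : ℂ) * i.factorial * (n - i).factorial = n.factorial := by
    exact_mod_cast Nat.choose_mul_factorial_mul_factorial hi'
  have h5 : (n.choose i : ℂ) ≠ 0 := by exact_mod_cast (Nat.choose_pos hi').ne'
  rw [← h4] at h3 ⊢
  field_simp

lemma szmT_congr (f g : ℂ → ℂ) (h : f =ᶠ[nhds 0] g) : szmT f = szmT g := by
  ext n
  simp [szmT, h.iteratedDeriv_eq]

lemma szmT_exp (c : ℂ) : szmT (fun w => Complex.exp (c * w)) = PowerSeries.rescale c (PowerSeries.exp ℂ) := by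
  ext n
  simp [szmT, iteratedDeriv_cexp_const_mul, PowerSeries.coeff_exp, div_eq_mul_inv]

lemma szmT_X : szmT (fun w => w) = PowerSeries.X := by
  ext n
  simp only [szmT, PowerSeries.coeff_mk, PowerSeries.coeff_X]
  rw [iteratedDeriv_fun_id]
  rcases n with _ | _ | n <;> simp

noncomputable def szmE (c : ℂ) : PowerSeries ℂ := PowerSeries.rescale c (PowerSeries.exp ℂ)

lemma szmE_add (a b : ℂ) : szmE (a + b) = szmE a * szmE b :=
  (PowerSeries.exp_mul_exp_eq_exp_add a b).symm

noncomputable def szmS (c : ℂ) : PowerSeries ℂ :=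
  szmE (π * I * c) - szmE (-(π * I * c))

lemma szmT_sin (c : ℂ) : PowerSeries.C (2 * I) * szmT (fun w => Complex.sin (π * c * w)) = szmS c := by
  have h : (fun w : ℂ => Complex.sin (π * c * w)) = fun w =>
      (-(I / 2)) * Complex.exp ((π * I * c) * w) + (I / 2) * Complex.exp (-(π * I * c) * w) := by
    funext w
    rw [Complex.sin, show -(π * c * w) * I = -(π * I * c) * w by ring,
      show (π * c * w) * I = (π * I * c) * w by ring]
    ring
  rw [h, szmS, szmE, szmE, ← szmT_exp, ← szmT_exp]
  ext n
  simp only [szmT, PowerSeries.coeff_mk, map_sub, PowerSeries.coeff_C_mul]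
  rw [iteratedDeriv_fun_add (by fun_prop) (by fun_prop), iteratedDeriv_const_mul_field,
    iteratedDeriv_const_mul_field]
  linear_combination ((-1) * iteratedDeriv n (fun w => Complex.exp (π * I * c * w)) 0 / (n.factorial : ℂ)
    + iteratedDeriv n (fun w => Complex.exp (-(π * I * c) * w)) 0 / (n.factorial : ℂ)) * Complex.I_mul_I

noncomputable def szmV : PowerSeries ℂ :=
  PowerSeries.mk fun m => ((2:ℂ) ^ ((m:ℤ) - 1) - 1) * (bernoulli m : ℂ) / (m.factorial : ℂ)

lemma szmV_spec : szmV * (szmE 1 - szmE (-1)) = - PowerSeries.X := by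
  set B := bernoulliPowerSeries ℂ with hB
  have hb : B * (szmE 1 - 1) = PowerSeries.X := by
    have := bernoulliPowerSeries_mul_exp_sub_one ℂ
    simpa [szmE] using this
  have hb2 : PowerSeries.rescale 2 B * (szmE 2 - 1) = PowerSeries.C 2 * PowerSeries.X := by
    have := congrArg (PowerSeries.rescale (2:ℂ)) (bernoulliPowerSeries_mul_exp_sub_one ℂ)
    simpa [szmE, PowerSeries.rescale_X] using this
  have hV : PowerSeries.C 2 * szmV = PowerSeries.rescale 2 B - PowerSeries.C 2 * B := by
    ext n
    simp only [szmV, hB, bernoulliPowerSeries, map_sub, PowerSeries.coeff_C_mul, PowerSeries.coeff_mk,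
      PowerSeries.coeff_rescale]
    rw [zpow_sub₀ (by norm_num)]
    simp
    ring
  have e2 : szmE 2 = szmE 1 * szmE 1 := by rw [← szmE_add]; norm_num
  have e0 : szmE 1 * szmE (-1) = 1 := by rw [← szmE_add]; simp [szmE]
  rw [e2] at hb2
  have hC : PowerSeries.C (2:ℂ) = 2 := map_ofNat _ 2
  rw [hC] at hb2 hV
  have h2 : (2 : PowerSeries ℂ) ≠ 0 := by
    rw [← hC]; simp
  apply mul_left_cancel₀ h2
  rw [← mul_assoc, hV]
  linear_combination szmE (-1) * hb2 - 2 * (1 + szmE (-1)) * hb +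
    (- (PowerSeries.rescale 2 B) * szmE 1 + 2 * B) * e0

noncomputable def szmW : PowerSeries ℂ :=
  PowerSeries.mk fun m => (eulerNumber m : ℂ) / (m.factorial : ℂ)

lemma szm_euler_odd (n : ℕ) (h : n % 2 = 1) : eulerNumber n = 0 := by
  rcases n with _ | n
  · simp at h
  · rw [eulerNumber, if_pos h]

lemma szm_euler_rec (n : ℕ) (hn : 0 < n) (h : n % 2 = 0) :
    ∑ m ∈ Finset.range (n / 2 + 1), (n.choose (2 * m) : ℚ) * eulerNumber (2 * m) = 0 := by
  obtain ⟨n, rfl⟩ : ∃ l, n = l + 1 := ⟨n - 1, by omega⟩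
  rw [Finset.sum_range_succ, show 2 * ((n + 1) / 2) = n + 1 by omega]
  conv_lhs => rw [eulerNumber.eq_2]
  rw [if_neg (by omega), Finset.sum_attach (Finset.range ((n + 1) / 2))
    (fun k => ((n + 1).choose (2 * k) : ℚ) * eulerNumber (2 * k))]
  simp

lemma szm_euler_sum (n : ℕ) (hn : 0 < n) :
    ∑ m ∈ Finset.range (n + 1), (n.choose m : ℚ) * eulerNumber m * (1 + (-1) ^ (n - m)) = 0 := by
  rcases Nat.mod_two_eq_zero_or_one n with h | h
  · have key : ∑ m ∈ Finset.range (n + 1), (n.choose m : ℚ) * eulerNumber m * (1 + (-1) ^ (n - m)) =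
        ∑ m ∈ Finset.range (n / 2 + 1), (n.choose (2 * m) : ℚ) * eulerNumber (2 * m) * 2 := by
      symm
      apply Finset.sum_of_injOn (fun m => 2 * m)
      · intro a _ b _ hab
        simpa using hab
      · intro a ha
        simp at ha ⊢
        omega
      · intro b hb hb2
        have : b % 2 = 1 := by
          by_contra hb3
          apply hb2
          simp at hb ⊢
          exact ⟨b / 2, by omega, by omega⟩
        rw [szm_euler_odd b this]; simp
      · intro a ha
        simp at ha
        have : Even (n - 2 * a) := by rw [Nat.even_iff]; omega
        rw [this.neg_one_pow]; ring
    rw [key, ← Finset.sum_mul, szm_euler_rec n hn h, zero_mul]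
  · apply Finset.sum_eq_zero
    intro m hm
    simp at hm
    rcases Nat.mod_two_eq_zero_or_one m with h2 | h2
    · have : Odd (n - m) := by rw [Nat.odd_iff]; omega
      rw [this.neg_one_pow]; simp
    · rw [szm_euler_odd m h2]; simp

lemma szmW_spec : szmW * (szmE 1 + szmE (-1)) = 2 := by
  ext n
  rw [PowerSeries.coeff_mul, Finset.Nat.sum_antidiagonal_eq_sum_range_succ_mk]
  simp only [szmW, szmE, PowerSeries.coeff_mk, map_add, PowerSeries.coeff_rescale, PowerSeries.coeff_exp]
  rcases Nat.eq_zero_or_pos n with rfl | hn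
  · simp [eulerNumber]
    rw [map_ofNat]
    norm_num
  · have h := szm_euler_sum n hn
    have h' : ∑ m ∈ Finset.range (n + 1), (n.choose m : ℂ) * (eulerNumber m : ℂ) * (1 + (-1) ^ (n - m)) = 0 := by
      exact_mod_cast h
    have hr : (PowerSeries.coeff n) (2 : PowerSeries ℂ) = 0 := by
      have : (2 : PowerSeries ℂ) = PowerSeries.C 2 := (map_ofNat _ 2).symm
      rw [this, PowerSeries.coeff_C, if_neg hn.ne']
    rw [hr]
    have h3 : (n.factorial : ℂ) ≠ 0 := by exact_mod_cast n.factorial_ne_zero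
    apply mul_left_cancel₀ h3
    rw [mul_zero, ← h', Finset.mul_sum]
    apply Finset.sum_congr rfl
    intro i hi
    have hi' : i ≤ n := by simp at hi; omega
    have h1 : (i.factorial : ℂ) ≠ 0 := by exact_mod_cast i.factorial_ne_zero
    have h2 : ((n - i).factorial : ℂ) ≠ 0 := by exact_mod_cast (n - i).factorial_ne_zero
    have h4 : (n.choose i : ℂ) * i.factorial * (n - i).factorial = n.factorial := by
      exact_mod_cast Nat.choose_mul_factorial_mul_factorial hi'
    rw [← h4]
    simp
    field_simp

noncomputable def szmSn (c : ℂ) : ℂ → ℂ := dslope (fun w => Complex.sin (π * c * w)) 0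

lemma szmSn_mul (c w : ℂ) : w * szmSn c w = Complex.sin (π * c * w) := by
  have := sub_smul_dslope (fun w : ℂ => Complex.sin (π * c * w)) 0 w
  simpa [szmSn] using this

lemma szmSn_diff (c : ℂ) : Differentiable ℂ (szmSn c) := by
  rw [← differentiableOn_univ]
  refine (Complex.differentiableOn_dslope Filter.univ_mem).2 ?_
  exact Differentiable.differentiableOn (by fun_prop)

lemma szmSn_zero (c : ℂ) : szmSn c 0 = π * c := by
  rw [szmSn, dslope_same]
  have : HasDerivAt (fun w : ℂ => Complex.sin (π * c * w)) (Complex.cos (π * c * 0) * (π * c * 1)) 0 :=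
    (Complex.hasDerivAt_sin _).comp (0:ℂ) ((hasDerivAt_id (0:ℂ)).const_mul (π * c))
  rw [this.deriv]; simp

lemma szmT_Sn (c : ℂ) : PowerSeries.C (2 * I) * (PowerSeries.X * szmT (szmSn c)) = szmS c := by
  rw [← szmT_sin, ← szmT_X, ← szmT_mul (fun w => w) _ analyticAt_id ((szmSn_diff c).analyticAt 0)]
  simp only [szmSn_mul]

lemma szmS_ne (c : ℂ) (hc : c ≠ 0) : szmS c ≠ 0 := by
  intro h
  have := congrArg (PowerSeries.coeff 1) h
  simp [szmS, szmE, PowerSeries.coeff_exp] at this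
  exact hc this

lemma szm_resc_E (a b : ℂ) : PowerSeries.rescale a (szmE b) = szmE (a * b) := by
  rw [szmE, szmE, PowerSeries.rescale_rescale, mul_comm]

lemma szm_formal (z : ℂ) (hp : 1 + z ≠ 0) (hq : 1 - z ≠ 0) (H : PowerSeries ℂ)
    (hH : H * (szmT (szmSn (1 + z)) * szmT (szmSn (1 - z))) = PowerSeries.C (π : ℂ) * szmT (szmSn z)) :
    H = PowerSeries.C (1 + z)⁻¹ *
          (PowerSeries.rescale (π * I * (1 + z)) szmV * PowerSeries.rescale (π * I) szmW) -
        PowerSeries.C (1 - z)⁻¹ *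
          (PowerSeries.rescale (π * I * (1 - z)) szmV * PowerSeries.rescale (π * I) szmW) := by
  have hV : ∀ c : ℂ, PowerSeries.rescale (π * I * c) szmV * szmS c =
      - (PowerSeries.C (π * I) * PowerSeries.C c * PowerSeries.X) := by
    intro c
    have := congrArg (PowerSeries.rescale (π * I * c)) szmV_spec
    rw [map_mul, map_sub, szm_resc_E, szm_resc_E, map_neg, PowerSeries.rescale_X] at this
    rw [← map_mul, ← this, szmS]
    simp
  have hW : PowerSeries.rescale (π * I) szmW * (szmE (π * I) + szmE (-(π * I))) = 2 := by
    have := congrArg (PowerSeries.rescale (π * I)) szmW_spec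
    rw [map_mul, map_add, szm_resc_E, szm_resc_E, map_ofNat] at this
    rw [← this]
    simp
  have hS : szmS (1 + z) - szmS (1 - z) = (szmE (π * I) + szmE (-(π * I))) * szmS z := by
    simp only [szmS]
    rw [show π * I * (1 + z) = π * I + π * I * z by ring,
      show -(π * I + π * I * z) = -(π * I) + -(π * I * z) by ring,
      show π * I * (1 - z) = π * I + -(π * I * z) by ring,
      show -(π * I + -(π * I * z)) = -(π * I) + (π * I * z) by ring,
      szmE_add, szmE_add, szmE_add, szmE_add]
    ring
  apply mul_right_cancel₀ (mul_ne_zero (szmS_ne _ hp) (szmS_ne _ hq))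
  have h1 : H * (szmS (1 + z) * szmS (1 - z)) =
      2 * PowerSeries.C (π * I) * PowerSeries.X * szmS z := by
    rw [← szmT_Sn, ← szmT_Sn, ← szmT_Sn]
    have hC : PowerSeries.C (2 * I) = 2 * PowerSeries.C I := by
      rw [map_mul, map_ofNat]
    rw [hC, map_mul]
    linear_combination (2 * PowerSeries.C I) ^ 2 * PowerSeries.X ^ 2 * hH
  have hcp : PowerSeries.C (1 + z)⁻¹ * PowerSeries.C (1 + z) = (1 : PowerSeries ℂ) := by
    rw [← map_mul, inv_mul_cancel₀ hp, map_one]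
  have hcq : PowerSeries.C (1 - z)⁻¹ * PowerSeries.C (1 - z) = (1 : PowerSeries ℂ) := by
    rw [← map_mul, inv_mul_cancel₀ hq, map_one]
  have e1 := hV (1 + z)
  have e2 := hV (1 - z)
  rw [h1]
  set Vp := PowerSeries.rescale (π * I * (1 + z)) szmV
  set Vq := PowerSeries.rescale (π * I * (1 - z)) szmV
  set W := PowerSeries.rescale (π * I) szmW
  set cp := (PowerSeries.C (1 + z)⁻¹ : PowerSeries ℂ)
  set cq := (PowerSeries.C (1 - z)⁻¹ : PowerSeries ℂ)
  set dp := (PowerSeries.C (1 + z) : PowerSeries ℂ)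
  set dq := (PowerSeries.C (1 - z) : PowerSeries ℂ)
  set t := (PowerSeries.C (π * I) : PowerSeries ℂ)
  linear_combination (-cp * W * szmS (1 - z)) * e1 + cq * W * szmS (1 + z) * e2
    + W * t * PowerSeries.X * szmS (1 - z) * hcp - W * t * PowerSeries.X * szmS (1 + z) * hcq
    - t * PowerSeries.X * szmS z * hW - t * PowerSeries.X * W * hS

lemma szm_coeff_term (k : ℕ) (c : ℂ) (hc : c ≠ 0) :
    PowerSeries.coeff k (PowerSeries.C c⁻¹ *
          (PowerSeries.rescale (π * I * c) szmV * PowerSeries.rescale (π * I) szmW)) =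
    ((π : ℂ) * I) ^ k / (k.factorial : ℂ) *
        ∑ m ∈ Finset.range (k + 1),
          ((2 : ℂ) ^ ((m : ℤ) - 1) - 1) * (bernoulli m : ℂ) * (eulerNumber (k - m) : ℂ) *
            (k.choose m : ℂ) * c ^ ((m : ℤ) - 1) := by
  rw [PowerSeries.coeff_C_mul, PowerSeries.coeff_mul, Finset.Nat.sum_antidiagonal_eq_sum_range_succ_mk,
    Finset.mul_sum, Finset.mul_sum]
  apply Finset.sum_congr rfl
  intro i hi
  have hi' : i ≤ k := by simp at hi; omega
  simp only [szmV, szmW, PowerSeries.coeff_rescale, PowerSeries.coeff_mk]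
  have h1 : (i.factorial : ℂ) ≠ 0 := by exact_mod_cast i.factorial_ne_zero
  have h2 : ((k - i).factorial : ℂ) ≠ 0 := by exact_mod_cast (k - i).factorial_ne_zero
  have h5 : (k.choose i : ℂ) ≠ 0 := by exact_mod_cast (Nat.choose_pos hi').ne'
  have h4 : (k.choose i : ℂ) * i.factorial * (k - i).factorial = k.factorial := by
    exact_mod_cast Nat.choose_mul_factorial_mul_factorial hi'
  have h6 : c ^ ((i:ℤ) - 1) = c ^ i * c⁻¹ := by
    rw [zpow_sub₀ hc]; simp [div_eq_mul_inv]
  have h7 : ((π : ℂ) * I) ^ k = (π * I) ^ i * (π * I) ^ (k - i) := by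
    rw [← pow_add]; congr 1; omega
  rw [← h4, h6, h7]
  rw [mul_pow (π * I : ℂ) c i]
  field_simp

lemma szm_taylor (z : ℂ) (hp : 1 + z ≠ 0) (hq : 1 - z ≠ 0) (k : ℕ) :
    iteratedDeriv k (fun w => (π * szmSn z w) / (szmSn (1 + z) w * szmSn (1 - z) w)) 0 / k.factorial =
    ((π : ℂ) * I) ^ k / (k.factorial : ℂ) *
        ∑ m ∈ Finset.range (k + 1),
          ((2 : ℂ) ^ ((m : ℤ) - 1) - 1) * (bernoulli m : ℂ) * (eulerNumber (k - m) : ℂ) *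
            (k.choose m : ℂ) * ((1 + z) ^ ((m : ℤ) - 1) - (1 - z) ^ ((m : ℤ) - 1)) := by
  set H : ℂ → ℂ := fun w => (π * szmSn z w) / (szmSn (1 + z) w * szmSn (1 - z) w) with hH
  have hpi : (π : ℂ) ≠ 0 := by exact_mod_cast Real.pi_ne_zero
  have h0 : szmSn (1 + z) 0 * szmSn (1 - z) 0 ≠ 0 := by
    rw [szmSn_zero, szmSn_zero]
    exact mul_ne_zero (mul_ne_zero hpi hp) (mul_ne_zero hpi hq)
  have a1 := (szmSn_diff (1 + z)).analyticAt 0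
  have a2 := (szmSn_diff (1 - z)).analyticAt 0
  have a3 := (szmSn_diff z).analyticAt 0
  have aH : AnalyticAt ℂ H 0 := (analyticAt_const.mul a3).div (a1.mul a2) h0
  have key : szmT H * (szmT (szmSn (1 + z)) * szmT (szmSn (1 - z))) =
      PowerSeries.C (π : ℂ) * szmT (szmSn z) := by
    rw [← szmT_mul _ _ a1 a2, ← szmT_mul H (fun w => szmSn (1 + z) w * szmSn (1 - z) w) aH (a1.mul a2)]
    have : szmT (fun w => H w * (szmSn (1 + z) w * szmSn (1 - z) w)) = szmT (fun w => π * szmSn z w) := by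
      apply szmT_congr
      filter_upwards [(a1.mul a2).continuousAt.eventually_ne h0] with w hw
      have hw' : szmSn (1 + z) w * szmSn (1 - z) w ≠ 0 := hw
      simp only [hH]
      exact div_mul_cancel₀ _ hw'
    rw [this]
    ext n
    simp [szmT, mul_div_assoc]
  have hf := szm_formal z hp hq (szmT H) key
  have hc := congrArg (PowerSeries.coeff k) hf
  rw [map_sub, szm_coeff_term k _ hp, szm_coeff_term k _ hq, ← mul_sub, ← Finset.sum_sub_distrib] at hc
  simp only [szmT, PowerSeries.coeff_mk] at hc
  rw [hc]
  congr 1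
  apply Finset.sum_congr rfl
  intro i _
  ring

lemma szmSn_neg (c w : ℂ) : szmSn (-c) w = - szmSn c w := by
  by_cases hw : w = 0
  · subst hw; rw [szmSn_zero, szmSn_zero]; ring
  · apply mul_left_cancel₀ hw
    rw [szmSn_mul, show w * -szmSn c w = -(w * szmSn c w) by ring, szmSn_mul, ← Complex.sin_neg]
    ring_nf

lemma szmSn_eq_zero (c w : ℂ) (hw : w ≠ 0) : szmSn c w = 0 ↔ Complex.sin (π * c * w) = 0 := by
  rw [← szmSn_mul]; simp [hw]

lemma szmSn_deriv (c a : ℂ) (ha : a ≠ 0) (h : szmSn c a = 0) :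
    deriv (szmSn c) a = π * c * Complex.cos (π * c * a) / a := by
  have h1 : HasDerivAt (fun w => w * szmSn c w) (1 * szmSn c a + a * deriv (szmSn c) a) a :=
    (hasDerivAt_id a).mul (szmSn_diff c a).hasDerivAt
  have h2 : HasDerivAt (fun w : ℂ => Complex.sin (π * c * w)) (Complex.cos (π * c * a) * (π * c * 1)) a :=
    (Complex.hasDerivAt_sin _).comp a ((hasDerivAt_id a).const_mul (π * c))
  simp only [szmSn_mul] at h1
  have := h1.unique h2
  rw [h] at this
  field_simp
  linear_combination this

lemma szm_sin_ne (z : ℝ) (hirr : Irrational z) (n : ℤ) (hn : n ≠ 0) :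
    Complex.sin (2 * (π * z * ((n : ℂ) / (1 + z)))) ≠ 0 := by
  intro h
  have hp : (1 + z : ℝ) ≠ 0 := by
    have := hirr.ne_int (-1)
    intro h; apply this; push_cast; linarith
  rw [Complex.sin_eq_zero_iff] at h
  obtain ⟨m, hm⟩ := h
  have h1 : 2 * (π * z * (n / (1 + z))) = m * π := by exact_mod_cast hm
  have h2 : z * (2 * n - m) = m := by
    have hpi := Real.pi_ne_zero
    field_simp at h1
    have h1 : 2 * z * n = m * (1 + z) := by
      apply mul_left_cancel₀ hpi
      linear_combination π * h1
    linear_combination h1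
  by_cases h3 : 2 * n - m = 0
  · have h4 : (2 * n - m : ℝ) = 0 := by exact_mod_cast h3
    rw [h4, mul_zero] at h2
    have : m = 0 := by exact_mod_cast h2.symm
    omega
  · have h4 : (2 * n - m : ℝ) ≠ 0 := by exact_mod_cast h3
    apply hirr
    refine ⟨(m : ℚ) / (2 * n - m), ?_⟩
    push_cast
    field_simp
    linarith

lemma szm_pole (z : ℝ) (hirr : Irrational z) (n : ℤ) (hn : n ≠ 0) (a : ℂ) (ha : a = (n : ℂ) / (1 + z)) (k : ℕ) :
    deriv (fun w => szmSn (1 + z) w * szmSn (1 - z) w) a ≠ 0 ∧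
    (π * szmSn z a) / deriv (fun w => szmSn (1 + z) w * szmSn (1 - z) w) a / a ^ (k + 1) =
      - 1 / (2 * (1 + z) * Complex.cos (π * z * a) * a ^ k) := by
  have hp : (1 + z : ℂ) ≠ 0 := by
    have := hirr.ne_int (-1)
    intro h; apply this; push_cast
    have : (1 + z : ℝ) = 0 := by exact_mod_cast h
    linarith
  have hn' : (n : ℂ) ≠ 0 := by exact_mod_cast hn
  have ha0 : a ≠ 0 := by rw [ha]; exact div_ne_zero hn' hp
  have hpi : (π : ℂ) ≠ 0 := by exact_mod_cast Real.pi_ne_zero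
  have hpa : π * (1 + z) * a = n * π := by rw [ha]; field_simp
  have hs0 : Complex.sin (π * (1 + z) * a) = 0 := by rw [hpa]; exact Complex.sin_int_mul_pi n
  have hsn0 : szmSn (1 + z) a = 0 := (szmSn_eq_zero _ _ ha0).2 hs0
  have hne := szm_sin_ne z hirr n hn
  rw [← ha, Complex.sin_two_mul] at hne
  have hs : Complex.sin (π * z * a) ≠ 0 := by intro h; apply hne; rw [h]; ring
  have hc : Complex.cos (π * z * a) ≠ 0 := by intro h; apply hne; rw [h]; ring
  have hcos2 : Complex.cos (π * (1 + z) * a) ^ 2 = 1 := by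
    have := Complex.sin_sq_add_cos_sq (π * (1 + z) * a)
    rw [hs0] at this; linear_combination this
  have hq : Complex.sin (π * (1 - z) * a) =
      - Complex.cos (π * (1 + z) * a) * (2 * Complex.sin (π * z * a) * Complex.cos (π * z * a)) := by
    rw [show π * (1 - z) * a = π * (1 + z) * a - 2 * (π * z * a) by ring, Complex.sin_sub, hs0,
      Complex.sin_two_mul]
    ring
  have hsq : szmSn (1 - z) a = Complex.sin (π * (1 - z) * a) / a := by
    rw [← szmSn_mul]; field_simp
  have hsz : szmSn z a = Complex.sin (π * z * a) / a := by
    rw [← szmSn_mul]; field_simp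
  have hder : deriv (fun w => szmSn (1 + z) w * szmSn (1 - z) w) a =
      - (2 * π * (1 + z) * Complex.sin (π * z * a) * Complex.cos (π * z * a)) / a ^ 2 := by
    rw [deriv_fun_mul (szmSn_diff _ _) (szmSn_diff _ _), hsn0, szmSn_deriv _ _ ha0 hsn0, hsq, hq]
    field_simp
    linear_combination (-(1 + z) * π * Complex.sin (π * z * a) * Complex.cos (π * z * a) * 2) * hcos2
  rw [hder]
  constructor
  · apply div_ne_zero _ (pow_ne_zero _ ha0)
    rw [neg_ne_zero]
    simp [hpi, hp, hs, hc]
  · rw [hsz]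
    field_simp
    ring

def szmZ (M : ℕ) : Finset ℤ :=
  (Finset.range M).image (fun j : ℕ => (j : ℤ) + 1) ∪ (Finset.range M).image (fun j : ℕ => -((j : ℤ) + 1))

lemma szmZ_mem (M : ℕ) (n : ℤ) : n ∈ szmZ M ↔ n ≠ 0 ∧ |n| ≤ M := by
  simp only [szmZ, Finset.mem_union, Finset.mem_image, Finset.mem_range]
  constructor
  · rintro (⟨j, hj, rfl⟩ | ⟨j, hj, rfl⟩)
    · refine ⟨by omega, ?_⟩
      rw [abs_le]; omega
    · refine ⟨by omega, ?_⟩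
      rw [abs_le]; omega
  · rintro ⟨h1, h2⟩
    rw [abs_le] at h2
    rcases lt_or_gt_of_ne h1 with h | h
    · right; exact ⟨(-n - 1).toNat, by omega, by omega⟩
    · left; exact ⟨(n - 1).toNat, by omega, by omega⟩

lemma szmZ_sum (M : ℕ) (f : ℤ → ℂ) (hf : ∀ n, f (-n) = f n) :
    ∑ n ∈ szmZ M, f n = 2 * ∑ j ∈ Finset.range M, f ((j : ℤ) + 1) := by
  rw [szmZ, Finset.sum_union, Finset.sum_image, Finset.sum_image]
  · simp only [hf]; ring
  · intro a _ b _ h; simp at h; exact h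
  · intro a _ b _ h; simp at h; exact h
  · rw [Finset.disjoint_left]
    intro n h1 h2
    simp only [Finset.mem_image, Finset.mem_range] at h1 h2
    obtain ⟨a, _, ha⟩ := h1
    obtain ⟨b, _, hb⟩ := h2
    omega

noncomputable def szmA (c : ℝ) (M : ℕ) : Finset ℂ := (szmZ M).image (fun n : ℤ => (n : ℂ) / c)

lemma szmA_sum (c : ℝ) (hc : c ≠ 0) (M : ℕ) (F : ℂ → ℂ) :
    ∑ a ∈ szmA c M, F a = ∑ n ∈ szmZ M, F ((n : ℂ) / c) := by
  rw [szmA, Finset.sum_image]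
  intro a _ b _ h
  have hc' : (c : ℂ) ≠ 0 := by exact_mod_cast hc
  simp only at h
  field_simp at h
  exact_mod_cast h

lemma szmA_mem (c R : ℝ) (hc : c ≠ 0) (hR : 0 ≤ R) (w : ℂ) (hw : ‖w‖ ≤ R) (hw0 : w ≠ 0) :
    w ∈ szmA c ⌊|c| * R⌋₊ ↔ Complex.sin (π * c * w) = 0 := by
  have hc' : (c : ℂ) ≠ 0 := by exact_mod_cast hc
  have hpi : (π : ℂ) ≠ 0 := by exact_mod_cast Real.pi_ne_zero
  simp only [szmA, Finset.mem_image, szmZ_mem]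
  rw [Complex.sin_eq_zero_iff]
  constructor
  · rintro ⟨n, _, rfl⟩
    exact ⟨n, by field_simp⟩
  · rintro ⟨n, hn⟩
    have hw1 : (n : ℂ) / c = w := by
      field_simp
      apply mul_left_cancel₀ hpi
      linear_combination -hn
    refine ⟨n, ⟨?_, ?_⟩, hw1⟩
    · rintro rfl
      apply hw0; rw [← hw1]; simp
    · have h1 : (n : ℂ) = c * w := by rw [← hw1]; field_simp
      have h2 : (|n| : ℝ) = |c| * ‖w‖ := by
        have := congrArg norm h1
        rw [norm_mul, Complex.norm_intCast, Complex.norm_real, Real.norm_eq_abs] at this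
        exact this
      have h3 : ((n.natAbs : ℕ) : ℝ) ≤ |c| * R := by
        rw [Nat.cast_natAbs]; push_cast; rw [h2]; gcongr
      have h4 := Nat.le_floor h3
      rw [Int.abs_eq_natAbs]
      exact_mod_cast h4

lemma szmA_ball (c R δ : ℝ) (hc : c ≠ 0) (hR : 0 < R) (hδ : 0 < δ)
    (h : ∀ n : ℤ, δ ≤ |(|c| * R) - n|) (w : ℂ) (hw : w ∈ szmA c ⌊|c| * R⌋₊) :
    w ∈ Metric.ball (0:ℂ) R ∧ ∃ n : ℤ, n ≠ 0 ∧ w = (n : ℂ) / c := by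
  simp only [szmA, Finset.mem_image, szmZ_mem] at hw
  obtain ⟨n, ⟨h1, h2⟩, rfl⟩ := hw
  refine ⟨?_, n, h1, rfl⟩
  have hc1 : 0 < |c| := abs_pos.2 hc
  have h3 : (|n| : ℝ) ≤ |c| * R := by
    have : ((|n| : ℤ) : ℝ) ≤ (⌊|c| * R⌋₊ : ℝ) := by exact_mod_cast h2
    have h5 := Nat.floor_le (a := |c| * R) (by positivity)
    push_cast at this
    linarith
  have h4 : (|n| : ℝ) < |c| * R := by
    apply lt_of_le_of_ne h3
    intro h6
    have := h |n|
    push_cast at this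
    rw [← h6] at this
    simp at this
    linarith
  simp only [mem_ball_zero_iff, norm_div, Complex.norm_intCast, Complex.norm_real, Real.norm_eq_abs]
  rw [div_lt_iff₀ hc1]
  linarith

lemma szm_disj (z : ℝ) (hirr : Irrational z) (hz1 : 1 + z ≠ 0) (hz2 : 1 - z ≠ 0) (M M' : ℕ) :
    Disjoint (szmA (1 + z) M) (szmA (1 - z) M') := by
  rw [Finset.disjoint_left]
  intro w h1 h2
  simp only [szmA, Finset.mem_image, szmZ_mem] at h1 h2
  obtain ⟨n, ⟨hn, _⟩, rfl⟩ := h1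
  obtain ⟨m, ⟨hm, _⟩, h⟩ := h2
  have h' : (m : ℝ) / (1 - z) = n / (1 + z) := by exact_mod_cast h
  field_simp at h'
  by_cases h3 : m + n = 0
  · have h4 : (m + n : ℝ) = 0 := by exact_mod_cast h3
    have h5 : (m - n : ℝ) = 0 := by linear_combination h' - z * h4
    have : m - n = 0 := by exact_mod_cast h5
    omega
  · have h4 : (m + n : ℝ) ≠ 0 := by exact_mod_cast h3
    apply hirr
    refine ⟨((n : ℚ) - m) / (m + n), ?_⟩
    push_cast
    field_simp
    linarith

lemma szm_term_sum (z : ℝ) (hp : 1 + z ≠ 0) (k : ℕ) (hk : 0 < k) (hkeven : Even k) (M : ℕ) :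
    ∑ n ∈ szmZ M, (- 1 / (2 * (1 + z) * Complex.cos (π * z * ((n : ℂ) / (1 + z))) * ((n : ℂ) / (1 + z)) ^ k)) =
    - (((1 + z : ℝ) ^ (k - 1) * ∑ n ∈ Finset.range M,
      1 / Real.cos (π * (n + 1) * (z / (1 + z))) / ((n : ℝ) + 1) ^ k : ℝ) : ℂ) := by
  have hp' : (1 + z : ℂ) ≠ 0 := by exact_mod_cast hp
  rw [szmZ_sum]
  · push_cast
    rw [Finset.mul_sum, Finset.mul_sum, ← Finset.sum_neg_distrib]
    apply Finset.sum_congr rfl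
    intro j _
    have hj : (j + 1 : ℂ) ≠ 0 := by exact_mod_cast j.succ_ne_zero
    rw [show (π * z * (((j : ℂ) + 1) / (1 + z)) : ℂ) = π * (j + 1) * (z / (1 + z)) by ring, div_pow]
    obtain ⟨l, rfl⟩ : ∃ l, k = l + 1 := ⟨k - 1, by omega⟩
    rw [Nat.add_sub_cancel, pow_succ (1 + z : ℂ)]
    by_cases hc : Complex.cos (π * (j + 1) * (z / (1 + z))) = 0
    · rw [hc]; simp
    · field_simp
  · intro n
    push_cast
    rw [show (-(n:ℂ)) / (1 + (z:ℂ)) = -((n:ℂ) / (1 + z)) by ring, mul_neg, Complex.cos_neg, hkeven.neg_pow]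

lemma szm_finite (k : ℕ) (hk : 0 < k) (hkeven : Even k)
    (z : ℝ) (hirr : Irrational z) (hz1 : 1 + z ≠ 0) (hz2 : 1 - z ≠ 0) (R δ : ℝ) (hR : 0 < R) (hδ : 0 < δ)
    (h1 : ∀ n : ℤ, δ ≤ |(|1 + z| * R) - n|) (h2 : ∀ n : ℤ, δ ≤ |(|1 - z| * R) - n|) :
    (∮ w in C(0, R), (1 / w ^ (k + 1)) * ((π * szmSn z w) / (szmSn (1 + z) w * szmSn (1 - z) w))) =
      2 * π * I * (iteratedDeriv k (fun w => (π * szmSn z w) / (szmSn (1 + z) w * szmSn (1 - z) w)) 0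
          / k.factorial +
        (- (((1 + z : ℝ) ^ (k - 1) * ∑ n ∈ Finset.range ⌊|1 + z| * R⌋₊,
            1 / Real.cos (π * (n + 1) * (z / (1 + z))) / ((n : ℝ) + 1) ^ k : ℝ) : ℂ) +
          (((1 - z : ℝ) ^ (k - 1) * ∑ n ∈ Finset.range ⌊|1 - z| * R⌋₊,
            1 / Real.cos (π * (n + 1) * (z / (1 - z))) / ((n : ℝ) + 1) ^ k : ℝ) : ℂ))) := by
  have hpi : (π : ℂ) ≠ 0 := by exact_mod_cast Real.pi_ne_zero
  have hp' : (1 + z : ℂ) ≠ 0 := by exact_mod_cast hz1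
  have hq' : (1 - z : ℂ) ≠ 0 := by exact_mod_cast hz2
  set S := szmA (1 + z) ⌊|1 + z| * R⌋₊ ∪ szmA (1 - z) ⌊|1 - z| * R⌋₊ with hS
  have hP : ∀ n : ℤ, n ≠ 0 →
      deriv (fun w => szmSn (1 + z) w * szmSn (1 - z) w) ((n : ℂ) / (1 + z)) ≠ 0 ∧
      (π * szmSn z ((n : ℂ) / (1 + z))) / deriv (fun w => szmSn (1 + z) w * szmSn (1 - z) w)
        ((n : ℂ) / (1 + z)) / ((n : ℂ) / (1 + z)) ^ (k + 1) =
      - 1 / (2 * (1 + z) * Complex.cos (π * z * ((n : ℂ) / (1 + z))) * ((n : ℂ) / (1 + z)) ^ k) :=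
    fun n hn => szm_pole z hirr n hn _ rfl k
  have hQ : ∀ n : ℤ, n ≠ 0 →
      deriv (fun w => szmSn (1 + z) w * szmSn (1 - z) w) ((n : ℂ) / (1 - z)) ≠ 0 ∧
      (π * szmSn z ((n : ℂ) / (1 - z))) / deriv (fun w => szmSn (1 + z) w * szmSn (1 - z) w)
        ((n : ℂ) / (1 - z)) / ((n : ℂ) / (1 - z)) ^ (k + 1) =
      - (- 1 / (2 * (1 + (-z : ℝ)) * Complex.cos (π * (-z : ℝ) * ((n : ℂ) / (1 + (-z : ℝ)))) *
        ((n : ℂ) / (1 + (-z : ℝ))) ^ k)) := by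
    intro n hn
    have := szm_pole (-z) hirr.neg n hn _ rfl k
    rw [← this.2]
    have h3 := this.1
    have hfun : (fun w => szmSn (1 + ((-z : ℝ) : ℂ)) w * szmSn (1 - ((-z : ℝ) : ℂ)) w) =
        (fun w => szmSn (1 + z) w * szmSn (1 - z) w) := by
      funext w
      push_cast
      rw [sub_neg_eq_add, ← sub_eq_add_neg, mul_comm]
    rw [hfun] at h3 ⊢
    have e : (1 + ((-z : ℝ) : ℂ)) = 1 - z := by push_cast; ring
    rw [e] at h3 ⊢
    refine ⟨h3, ?_⟩
    rw [Complex.ofReal_neg, szmSn_neg]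
    ring
  have key := szm_residue R hR k S (fun w => π * szmSn z w) (fun w => szmSn (1 + z) w * szmSn (1 - z) w)
    ((szmSn_diff _).const_mul _) ((szmSn_diff _).mul (szmSn_diff _)) ?_ ?_
  · rw [key]
    congr 2
    rw [hS, Finset.sum_union (szm_disj z hirr hz1 hz2 _ _), szmA_sum _ hz1, szmA_sum _ hz2]
    push_cast
    congr 1
    · have := szm_term_sum z hz1 k hk hkeven ⌊|1 + z| * R⌋₊
      push_cast at this
      rw [← this]
      apply Finset.sum_congr rfl
      intro n hn
      exact (hP n ((szmZ_mem _ _).1 hn).1).2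
    · have := szm_term_sum (-z) (by simpa [← sub_eq_add_neg] using hz2) k hk hkeven ⌊|1 - z| * R⌋₊
      have h5 : ∀ n : ℕ, Real.cos (π * (n + 1) * (-z / (1 + -z))) = Real.cos (π * (n + 1) * (z / (1 - z))) := by
        intro n
        rw [← Real.cos_neg, ← sub_eq_add_neg]
        congr 1; ring
      simp only [h5] at this
      rw [← sub_eq_add_neg] at this
      push_cast at this
      rw [← neg_eq_iff_eq_neg] at this
      rw [← this, ← Finset.sum_neg_distrib]
      apply Finset.sum_congr rfl
      intro n hn
      rw [(hQ n ((szmZ_mem _ _).1 hn).1).2]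
      push_cast
      rfl
  · intro w hw
    rw [mem_closedBall_zero_iff] at hw
    by_cases hw0 : w = 0
    · subst hw0
      simp only [szmSn_zero]
      constructor
      · intro h
        simp [hpi, hp', hq'] at h
      · intro h
        exfalso
        rw [hS, Finset.mem_union] at h
        rcases h with h | h
        · obtain ⟨_, n, hn, h3⟩ := szmA_ball _ R δ hz1 hR hδ h1 _ h
          have hn' : (n : ℂ) ≠ 0 := by exact_mod_cast hn
          push_cast at h3
          exact div_ne_zero hn' hp' h3.symm
        · obtain ⟨_, n, hn, h3⟩ := szmA_ball _ R δ hz2 hR hδ h2 _ h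
          have hn' : (n : ℂ) ≠ 0 := by exact_mod_cast hn
          push_cast at h3
          exact div_ne_zero hn' hq' h3.symm
    · rw [mul_eq_zero, szmSn_eq_zero _ _ hw0, szmSn_eq_zero _ _ hw0, hS, Finset.mem_union,
        szmA_mem _ R hz1 hR.le w hw hw0, szmA_mem _ R hz2 hR.le w hw hw0]
      push_cast
      rfl
  · intro a ha
    rw [hS, Finset.mem_union] at ha
    rcases ha with h | h
    · obtain ⟨h4, n, hn, h3⟩ := szmA_ball _ R δ hz1 hR hδ h1 _ h
      have hn' : (n : ℂ) ≠ 0 := by exact_mod_cast hn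
      push_cast at h3
      refine ⟨h4, ?_, ?_⟩
      · rw [h3]; exact div_ne_zero hn' hp'
      · rw [h3]; exact (hP n hn).1
    · obtain ⟨h4, n, hn, h3⟩ := szmA_ball _ R δ hz2 hR hδ h2 _ h
      have hn' : (n : ℂ) ≠ 0 := by exact_mod_cast hn
      push_cast at h3
      refine ⟨h4, ?_, ?_⟩
      · rw [h3]; exact div_ne_zero hn' hq'
      · rw [h3]; exact (hQ n hn).1

lemma szm_integral_bound (k : ℕ) (hk : 2 ≤ k) (z R δ : ℝ) (hδ : 0 < δ) (hR : 1 ≤ R)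
    (h1 : ∀ n : ℤ, δ ≤ |(|1 + z| * R) - n|) (h2 : ∀ n : ℤ, δ ≤ |(|1 - z| * R) - n|) :
    ‖∮ w in C(0, R), (1 / w ^ (k + 1)) * ((π * szmSn z w) / (szmSn (1 + z) w * szmSn (1 - z) w))‖ ≤
      2 * π * (π * (1 + π ^ 2 / (4 * (π * δ) ^ 2))) * R⁻¹ := by
  set K := 1 + π ^ 2 / (4 * (π * δ) ^ 2) with hK
  have hK0 : 0 ≤ K := by positivity
  have hR0 : 0 < R := by linarith
  have hb := circleIntegral.norm_integral_le_of_norm_le_const (c := 0) (R := R) (C := π * K * (R⁻¹) ^ 2)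
    (f := fun w => (1 / w ^ (k + 1)) * ((π * szmSn z w) / (szmSn (1 + z) w * szmSn (1 - z) w)))
    hR0.le ?_
  · refine hb.trans (le_of_eq ?_)
    field_simp
  · intro w hw
    rw [mem_sphere_zero_iff_norm] at hw
    have hw0 : w ≠ 0 := by
      rintro rfl
      simp at hw; linarith
    have hb2 := szm_bound z R δ hδ hR0.le h1 h2 w hw
    push_cast at hb2
    rw [← hK] at hb2
    have e : (1 / w ^ (k + 1)) * ((π * szmSn z w) / (szmSn (1 + z) w * szmSn (1 - z) w)) =
        (1 / w ^ k) * (π * (Complex.sin (π * z * w) /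
          (Complex.sin (π * (1 + z) * w) * Complex.sin (π * (1 - z) * w)))) := by
      rw [← szmSn_mul, ← szmSn_mul, ← szmSn_mul,
        show w * szmSn (1 + z) w * (w * szmSn (1 - z) w) = w * (w * (szmSn (1 + z) w * szmSn (1 - z) w)) by ring,
        mul_div_mul_left _ _ hw0]
      rw [pow_succ]
      simp only [div_eq_mul_inv, mul_inv]
      ring
    rw [e, norm_mul, norm_mul, norm_div, norm_one, norm_pow, hw, Complex.norm_real,
      Real.norm_of_nonneg Real.pi_pos.le]
    have hq : ‖Complex.sin (π * z * w) /
          (Complex.sin (π * (1 + z) * w) * Complex.sin (π * (1 - z) * w))‖ ≤ K := by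
      rw [norm_div, norm_mul]
      exact div_le_of_le_mul₀ (by positivity) hK0 hb2
    have hrk : 1 / R ^ k ≤ (R⁻¹) ^ 2 := by
      rw [inv_pow, one_div]
      apply inv_anti₀ (by positivity)
      exact pow_le_pow_right₀ hR hk
    calc 1 / R ^ k * (π * _) ≤ (R⁻¹) ^ 2 * (π * K) := by gcongr
      _ = _ := by ring

theorem secant_zeta_modular_transformation (k : ℕ) (hk : 0 < k) (hkeven : Even k)
    (z : ℝ) (hirr : Irrational z) (halg : IsAlgebraic ℚ z)
    (hz1 : (1 : ℝ) + z ≠ 0) (hz2 : (1 : ℝ) - z ≠ 0)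
    (hs1 : Summable (fun n : ℕ =>
      |1 / Real.cos (π * (n + 1) * (z / (1 + z)))| / ((n : ℝ) + 1) ^ k))
    (hs2 : Summable (fun n : ℕ =>
      |1 / Real.cos (π * (n + 1) * (z / (1 - z)))| / ((n : ℝ) + 1) ^ k)) :
    (((1 + z : ℝ) ^ (k - 1) *
        ∑' n : ℕ, 1 / Real.cos (π * (n + 1) * (z / (1 + z))) / ((n : ℝ) + 1) ^ k : ℝ) : ℂ) -
      (((1 - z : ℝ) ^ (k - 1) *
        ∑' n : ℕ, 1 / Real.cos (π * (n + 1) * (z / (1 - z))) / ((n : ℝ) + 1) ^ k : ℝ) : ℂ) =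
      ((π : ℂ) * Complex.I) ^ k / (k.factorial : ℂ) *
        ∑ m ∈ Finset.range (k + 1),
          ((2 : ℂ) ^ ((m : ℤ) - 1) - 1) * (bernoulli m : ℂ) * (eulerNumber (k - m) : ℂ) *
            (k.choose m : ℂ) *
            (((1 + z : ℝ) : ℂ) ^ ((m : ℤ) - 1) - ((1 - z : ℝ) : ℂ) ^ ((m : ℤ) - 1)) := by
  have hk2 : 2 ≤ k := by
    obtain ⟨l, hl⟩ := hkeven
    omega
  have hz1' : (1 + z : ℂ) ≠ 0 := by exact_mod_cast hz1
  have hz2' : (1 - z : ℂ) ≠ 0 := by exact_mod_cast hz2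
  obtain ⟨δ, hδ, hrad⟩ := szm_radius |1 + z| |1 - z| (abs_pos.2 hz1) (abs_pos.2 hz2)
  choose r hr1 hr2 using fun j : ℕ => hrad ((j : ℝ) + 1)
  have hr_ge : ∀ j, 1 ≤ r j := fun j => by
    have := hr1 j
    have h0 : (0:ℝ) ≤ j := j.cast_nonneg
    linarith
  have hr_top : Filter.Tendsto r Filter.atTop Filter.atTop := by
    apply Filter.tendsto_atTop_mono (f := fun j : ℕ => (j : ℝ))
    · intro j
      have := hr1 j
      linarith
    · exact tendsto_natCast_atTop_atTop
  have ht := szm_taylor (z : ℂ) hz1' hz2' k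
  set L : ℂ := ((π : ℂ) * Complex.I) ^ k / (k.factorial : ℂ) *
        ∑ m ∈ Finset.range (k + 1),
          ((2 : ℂ) ^ ((m : ℤ) - 1) - 1) * (bernoulli m : ℂ) * (eulerNumber (k - m) : ℂ) *
            (k.choose m : ℂ) * ((1 + (z : ℂ)) ^ ((m : ℤ) - 1) - (1 - (z : ℂ)) ^ ((m : ℤ) - 1)) with hL
  have hgoal : ((π : ℂ) * Complex.I) ^ k / (k.factorial : ℂ) *
        ∑ m ∈ Finset.range (k + 1),
          ((2 : ℂ) ^ ((m : ℤ) - 1) - 1) * (bernoulli m : ℂ) * (eulerNumber (k - m) : ℂ) *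
            (k.choose m : ℂ) *
            (((1 + z : ℝ) : ℂ) ^ ((m : ℤ) - 1) - ((1 - z : ℝ) : ℂ) ^ ((m : ℤ) - 1)) = L := by
    rw [hL]; push_cast; rfl
  rw [hgoal]
  set f1 : ℕ → ℝ := fun n => 1 / Real.cos (π * (n + 1) * (z / (1 + z))) / ((n : ℝ) + 1) ^ k with hf1
  set f2 : ℕ → ℝ := fun n => 1 / Real.cos (π * (n + 1) * (z / (1 - z))) / ((n : ℝ) + 1) ^ k with hf2
  have hsum1 : Summable f1 := by
    apply Summable.of_norm
    refine hs1.congr fun n => ?_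
    show |1 / Real.cos (π * (n + 1) * (z / (1 + z)))| / ((n : ℝ) + 1) ^ k =
      |1 / Real.cos (π * (n + 1) * (z / (1 + z))) / ((n : ℝ) + 1) ^ k|
    rw [abs_div (1 / Real.cos _) (((n : ℝ) + 1) ^ k),
      abs_of_pos (a := ((n : ℝ) + 1) ^ k) (by positivity)]
  have hsum2 : Summable f2 := by
    apply Summable.of_norm
    refine hs2.congr fun n => ?_
    show |1 / Real.cos (π * (n + 1) * (z / (1 - z)))| / ((n : ℝ) + 1) ^ k =
      |1 / Real.cos (π * (n + 1) * (z / (1 - z))) / ((n : ℝ) + 1) ^ k|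
    rw [abs_div (1 / Real.cos _) (((n : ℝ) + 1) ^ k),
      abs_of_pos (a := ((n : ℝ) + 1) ^ k) (by positivity)]
  have hfl : ∀ c : ℝ, c ≠ 0 → Filter.Tendsto (fun j => ⌊|c| * r j⌋₊) Filter.atTop Filter.atTop :=
    fun c hc => tendsto_nat_floor_atTop.comp (hr_top.const_mul_atTop (abs_pos.2 hc))
  have hT1 := hsum1.hasSum.tendsto_sum_nat.comp (hfl _ hz1)
  have hT2 := hsum2.hasSum.tendsto_sum_nat.comp (hfl _ hz2)
  have hT1' := (Complex.continuous_ofReal.tendsto _).comp (hT1.const_mul ((1 + z) ^ (k - 1)))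
  have hT2' := (Complex.continuous_ofReal.tendsto _).comp (hT2.const_mul ((1 - z) ^ (k - 1)))
  have hlim := ((hT1'.neg.add hT2').const_add L).const_mul (2 * π * Complex.I)
  have hzero : Filter.Tendsto (fun j => ∮ w in C(0, r j), (1 / w ^ (k + 1)) *
      ((π * szmSn z w) / (szmSn (1 + z) w * szmSn (1 - z) w))) Filter.atTop (nhds 0) := by
    apply squeeze_zero_norm (fun j => szm_integral_bound k hk2 z (r j) δ hδ (hr_ge j)
      (fun n => (hr2 j n).1) (fun n => (hr2 j n).2))
    have := (tendsto_inv_atTop_zero.comp hr_top).const_mul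
      (2 * π * (π * (1 + π ^ 2 / (4 * (π * δ) ^ 2))))
    rw [mul_zero] at this
    exact this
  have hfin : (fun j => ∮ w in C(0, r j), (1 / w ^ (k + 1)) *
      ((π * szmSn z w) / (szmSn (1 + z) w * szmSn (1 - z) w))) = _ := funext fun j =>
    szm_finite k hk hkeven z hirr hz1 hz2 (r j) δ (by linarith [hr_ge j]) hδ
      (fun n => (hr2 j n).1) (fun n => (hr2 j n).2)
  rw [hfin, ht] at hzero
  have huniq := tendsto_nhds_unique hzero hlim
  have h2pi : (2 * π * Complex.I : ℂ) ≠ 0 := Complex.two_pi_I_ne_zero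
  have h3 := (mul_eq_zero.1 huniq.symm).resolve_left h2pi
  linear_combination -h3
end

section
/- For every nonzero integer j, ψ_2(√(2j(2j+1))) = (3j+1)π²/6, where ψ_2(z) = ∑_{n=1}^∞ sec(πnz)/n². -/
open Real

lemma bad_approx (D : ℕ) (hD : ¬ IsSquare D) (d p : ℤ) (hd : d ≠ 0) :
    1 / ((2 * √(D:ℝ) + 1) * |(d:ℝ)|) ≤ |d * √(D:ℝ) - p| := by
  have ha : 0 ≤ √(D:ℝ) := Real.sqrt_nonneg _
  have hsq : √(D:ℝ) ^ 2 = D := Real.sq_sqrt (by positivity)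
  have hd1 : (1:ℝ) ≤ |(d:ℝ)| := by
    rw [← Int.cast_abs]; exact_mod_cast Int.one_le_abs hd
  have hne : d ^ 2 * D - p ^ 2 ≠ 0 := by
    intro h
    have h1 : Irrational √(D:ℝ) := by
      rw [irrational_sqrt_natCast_iff]; exact hD
    have h2 := h1.intCast_mul hd
    apply (irrational_iff_ne_rational _).1 h2 |p| 1 one_ne_zero
    have : (d * √(D:ℝ)) ^ 2 = (p:ℝ)^2 := by
      rw [mul_pow, hsq]
      have : ((d ^ 2 * D - p ^ 2 : ℤ):ℝ) = 0 := by rw [h]; simp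
      push_cast at this; linarith
    exfalso
    rcases sq_eq_sq_iff_eq_or_eq_neg.1 this with h | h
    · exact (irrational_iff_ne_rational _).1 h2 p 1 one_ne_zero (by simpa using h)
    · exact (irrational_iff_ne_rational _).1 h2 (-p) 1 one_ne_zero (by simpa using h)
  have h1 : (1:ℝ) ≤ |d * √(D:ℝ) - p| * |d * √(D:ℝ) + p| := by
    rw [← abs_mul]
    have : (d * √(D:ℝ) - p) * (d * √(D:ℝ) + p) = ((d ^ 2 * D - p ^ 2 : ℤ):ℝ) := by
      push_cast; linear_combination (d:ℝ)^2 * hsq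
    rw [this, ← Int.cast_abs]; exact_mod_cast Int.one_le_abs hne
  have hpos : 0 < (2 * √(D:ℝ) + 1) * |(d:ℝ)| := by positivity
  rw [div_le_iff₀ hpos]
  by_cases hc : 1 ≤ |d * √(D:ℝ) - p|
  · have : 1 ≤ (2 * √(D:ℝ) + 1) * |(d:ℝ)| := by nlinarith
    nlinarith
  · push Not at hc
    have : |d * √(D:ℝ) + p| ≤ (2 * √(D:ℝ) + 1) * |(d:ℝ)| := by
      have e : d * √(D:ℝ) + p = 2 * (d * √(D:ℝ)) - (d * √(D:ℝ) - p) := by ring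
      rw [e]
      refine (abs_sub _ _).trans ?_
      rw [abs_mul, abs_mul, abs_of_nonneg ha, abs_two]
      nlinarith
    nlinarith [abs_nonneg (d * √(D:ℝ) - p)]

lemma summ_nat (D : ℕ) (hD : ¬ IsSquare D) :
    Summable fun n : ℕ => 1 / cos (π * (n + 1) * √(D:ℝ)) / ((n:ℝ) + 1) ^ 2 := by
  set a := √(D:ℝ) with ha
  have ha0 : 0 ≤ a := Real.sqrt_nonneg _
  set c := 1 / (2 * a + 1) with hc
  have hc0 : 0 < c := by positivity
  let e : ℕ → ℝ := fun n => (n + 1) * a - 1 / 2 - round (((n:ℝ) + 1) * a - 1 / 2)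
  have he : ∀ n, |e n| ≤ 1 / 2 := fun n => abs_sub_round _
  have hcos : ∀ n : ℕ, 2 * |e n| ≤ |cos (π * (n + 1) * a)| := by
    intro n
    have h1 : π * (n + 1) * a = π * e n + π / 2 + (round (((n:ℝ) + 1) * a - 1 / 2) : ℤ) * π := by
      simp only [e]; ring
    rw [h1, Real.cos_add_int_mul_pi, abs_mul, abs_zpow, abs_neg, abs_one, one_zpow, one_mul, Real.cos_add_pi_div_two, abs_neg]
    have := Real.mul_abs_le_abs_sin (x := π * e n) (by
      rw [abs_mul, abs_of_pos pi_pos]; nlinarith [he n, pi_pos])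
    rw [abs_mul, abs_of_pos pi_pos] at this
    calc 2 * |e n| = 2 / π * (π * |e n|) := by field_simp
      _ ≤ _ := this
  have hbad : ∀ d p : ℤ, d ≠ 0 → c / |(d:ℝ)| ≤ |d * a - p| := by
    intro d p hd
    have := bad_approx D hD d p hd
    rw [hc, div_div]; exact this
  let k : ℕ → ℕ := fun n => Nat.log 2 (n + 1)
  have hk1 : ∀ n, ((2:ℝ) ^ k n) ≤ n + 1 := by
    intro n; exact_mod_cast Nat.pow_log_le_self 2 (Nat.succ_ne_zero n)
  have hk2 : ∀ n : ℕ, ((n:ℝ) + 1) < 2 * 2 ^ k n := by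
    intro n
    have := Nat.lt_pow_succ_log_self (b := 2) (by norm_num) (n + 1)
    rw [pow_succ, mul_comm] at this
    exact_mod_cast this
  have hlow : ∀ n, c / (8 * 2 ^ k n) ≤ |e n| := by
    intro n
    have h := hbad (2 * (n + 1)) (1 + 2 * round (((n:ℝ) + 1) * a - 1 / 2)) (by omega)
    have h2 : ((2 * (n + 1) : ℤ):ℝ) * a - ((1 + 2 * round (((n:ℝ) + 1) * a - 1 / 2) : ℤ):ℝ) = 2 * e n := by
      simp only [e]; push_cast; ring
    rw [h2, abs_mul, abs_two] at h
    have h3 : |((2 * (n + 1) : ℤ):ℝ)| = 2 * (n + 1) := by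
      push_cast; exact abs_of_pos (by positivity)
    rw [h3] at h
    have h4 : c / (4 * 2 ^ k n) ≤ c / (2 * (n + 1)) := by
      apply div_le_div_of_nonneg_left hc0.le (by positivity)
      linarith [hk2 n]
    have h5 : c / (8 * 2 ^ k n) = c / (4 * 2 ^ k n) / 2 := by ring
    linarith
  have hsep : ∀ n m, k n = k m → n ≠ m → c / 2 ^ k n ≤ |e n - e m| := by
    intro n m hkk hnm
    have h := hbad ((n:ℤ) - m) (round (((n:ℝ) + 1) * a - 1 / 2) - round (((m:ℝ) + 1) * a - 1 / 2)) (by omega)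
    have h2 : (((n:ℤ) - m : ℤ) : ℝ) * a - ((round (((n:ℝ) + 1) * a - 1 / 2) - round (((m:ℝ) + 1) * a - 1 / 2) : ℤ):ℝ) = e n - e m := by
      simp only [e]; push_cast; ring
    rw [h2] at h
    refine le_trans ?_ h
    apply div_le_div_of_nonneg_left hc0.le
    · rw [abs_pos]; push_cast; rw [sub_ne_zero]; exact_mod_cast hnm
    · push_cast
      rw [abs_le]
      have := hk1 n; have := hk2 n; have h3 := hk1 m; have h4 := hk2 m
      rw [← hkk] at h3 h4
      constructor <;> linarith
  let M : ℕ → ℝ := fun k => 8 * 2 ^ k / c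
  have hM : ∀ k, 0 < M k := fun k => by simp only [M]; positivity
  let b : ℕ → ℤ := fun n => ⌊e n * M (k n)⌋
  have hinj : Function.Injective (fun n => ((k n, b n) : ℕ × ℤ)) := by
    intro n m h
    simp only [Prod.mk.injEq] at h
    obtain ⟨h1, h2⟩ := h
    by_contra hne
    have h3 := hsep n m h1 hne
    have h4 := Int.abs_sub_lt_one_of_floor_eq_floor h2
    rw [← h1, ← sub_mul, abs_mul, abs_of_pos (hM _)] at h4
    have h5 : c / 2 ^ k n * M (k n) = 8 := by simp only [M]; field_simp
    nlinarith [hM (k n)]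
  have hy : ∀ n, 1 ≤ |e n * M (k n)| := by
    intro n
    rw [abs_mul, abs_of_pos (hM _)]
    have : c / (8 * 2 ^ k n) * M (k n) = 1 := by simp only [M]; field_simp
    rw [← this]; exact mul_le_mul_of_nonneg_right (hlow n) (hM _).le
  have hb1 : ∀ n, |(b n : ℝ)| ≤ 2 * |e n * M (k n)| := by
    intro n
    have h1 := Int.floor_le (e n * M (k n))
    have h2 := Int.lt_floor_add_one (e n * M (k n))
    have h3 := hy n
    change (b n:ℝ) ≤ _ at h1
    change _ < (b n:ℝ) + 1 at h2
    have h4 : |(b n : ℝ) - e n * M (k n)| ≤ 1 := by rw [abs_le]; constructor <;> linarith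
    have := abs_sub_abs_le_abs_sub (b n : ℝ) (e n * M (k n))
    linarith
  have hb0 : ∀ n, b n ≠ 0 := by
    intro n h
    have h1 := Int.floor_le (e n * M (k n))
    have h2 := Int.lt_floor_add_one (e n * M (k n))
    change (b n:ℝ) ≤ _ at h1
    change _ < (b n:ℝ) + 1 at h2
    rw [h] at h1 h2
    push_cast at h1 h2
    have h3 := hy n
    rw [abs_of_nonneg h1] at h3
    linarith
  have hb0' : ∀ n, 0 < |(b n : ℝ)| := fun n => abs_pos.2 (by exact_mod_cast hb0 n)
  have hb2 : ∀ n, |(b n : ℝ)| ≤ M (k n) := by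
    intro n
    have := hb1 n
    rw [abs_mul, abs_of_pos (hM _)] at this
    nlinarith [he n, hM (k n)]
  have hS1 : Summable fun z : ℤ => |(z:ℝ)| ^ (-(3/2) : ℝ) := Real.summable_abs_int_rpow (by norm_num)
  have hS2 : Summable fun i : ℕ => (8 / c) ^ (3/2:ℝ) * ((2:ℝ) ^ (-(1/2):ℝ)) ^ i := by
    apply Summable.mul_left
    apply summable_geometric_of_lt_one (by positivity)
    exact Real.rpow_lt_one_of_one_lt_of_neg (by norm_num) (by norm_num)
  have hS := hS2.mul_of_nonneg hS1 (fun i => by positivity) (fun i => by positivity)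
  refine Summable.of_norm_bounded (hS.comp_injective hinj) ?_
  intro n
  simp only [Function.comp]
  have hen : 0 < |e n| := lt_of_lt_of_le (by positivity) (hlow n)
  rw [norm_div, norm_div, norm_one, Real.norm_eq_abs, norm_pow, Real.norm_eq_abs, abs_of_pos (by positivity : (0:ℝ) < (n:ℝ) + 1)]
  have key : (8 / c) ^ (3/2:ℝ) * ((2:ℝ) ^ (-(1/2):ℝ)) ^ (k n) = (M (k n)) ^ (3/2:ℝ) / (2 ^ k n) ^ 2 := by
    have : M (k n) = (8 / c) * 2 ^ k n := by simp only [M]; ring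
    rw [this, Real.mul_rpow (by positivity) (by positivity), mul_div_assoc]
    congr 1
    rw [← Real.rpow_natCast, ← Real.rpow_natCast, ← Real.rpow_natCast, ← Real.rpow_mul (by norm_num), ← Real.rpow_mul (by norm_num),
      ← Real.rpow_mul (by norm_num), ← Real.rpow_sub (by norm_num)]
    congr 1; push_cast; ring
  rw [key]
  have h32 : ∀ t : ℝ, 0 < t → t ^ (3/2:ℝ) = t * t ^ (1/2:ℝ) := by
    intro t ht
    nth_rw 2 [← Real.rpow_one t]; rw [← Real.rpow_add ht]; norm_num
  calc 1 / |cos (π * (n + 1) * a)| / ((n:ℝ) + 1) ^ 2 ≤ 1 / (2 * |e n|) / (2 ^ k n) ^ 2 := by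
        gcongr
        · exact hcos n
        · exact hk1 n
    _ ≤ M (k n) / |(b n : ℝ)| / (2 ^ k n) ^ 2 := by
        gcongr ?_ / _
        rw [div_le_div_iff₀ (by positivity) (hb0' n)]
        have := hb1 n
        rw [abs_mul, abs_of_pos (hM _)] at this
        linarith
    _ ≤ (M (k n)) ^ (3/2:ℝ) / (2 ^ k n) ^ 2 * |(b n : ℝ)| ^ (-(3/2) : ℝ) := by
        rw [Real.rpow_neg (hb0' n).le, ← div_eq_mul_inv]
        refine le_of_le_of_eq (div_le_div_of_nonneg_right (c := ((2:ℝ) ^ k n) ^ 2)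
          (b := (M (k n)) ^ (3/2:ℝ) / |(b n : ℝ)| ^ (3/2:ℝ)) ?_ (by positivity)) (by ring)
        rw [h32 _ (hM _), h32 _ (hb0' n), div_le_div_iff₀ (hb0' n) (by have := hb0' n; positivity)]
        have : |(b n : ℝ)| ^ (1/2:ℝ) ≤ (M (k n)) ^ (1/2:ℝ) := Real.rpow_le_rpow (hb0' n).le (hb2 n) (by norm_num)
        have h1 := mul_le_mul_of_nonneg_left this (mul_pos (hM (k n)) (hb0' n)).le
        linarith


/-- `f` agrees with an analytic function in a punctured neighbourhood of `p`. -/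
def Reg (f : ℂ → ℂ) (p : ℂ) : Prop := ∃ g, AnalyticAt ℂ g p ∧ f =ᶠ[nhdsWithin p {p}ᶜ] g

lemma AnalyticAt.reg {f : ℂ → ℂ} {p : ℂ} (h : AnalyticAt ℂ f p) : Reg f p := ⟨f, h, .rfl⟩

lemma Reg.add {f g : ℂ → ℂ} {p : ℂ} (hf : Reg f p) (hg : Reg g p) :
    Reg (fun z => f z + g z) p := by
  obtain ⟨a, ha, ha'⟩ := hf
  obtain ⟨b, hb, hb'⟩ := hg
  exact ⟨fun z => a z + b z, ha.add hb, ha'.add hb'⟩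

lemma analyticAt_dslope' {f : ℂ → ℂ} {p : ℂ} (h : AnalyticAt ℂ f p) :
    AnalyticAt ℂ (dslope f p) p := by
  obtain ⟨s, hs⟩ := h
  exact ⟨_, hs.has_fpower_series_dslope_fslope⟩

lemma reg_simple_pole {N U V : ℂ → ℂ} {p c V' : ℂ} (hN : AnalyticAt ℂ N p)
    (hU : AnalyticAt ℂ U p) (hV : AnalyticAt ℂ V p) (hU0 : U p ≠ 0) (hV0 : V p = 0)
    (hd : HasDerivAt V V' p) (hV' : V' ≠ 0) (hc : N p = c * (U p * V')) :
    Reg (fun z => N z / (U z * V z) - c / (z - p)) p := by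
  have hdV : dslope V p p = V' := by rw [dslope_same, hd.deriv]
  have hψ : AnalyticAt ℂ (fun z => N z / (U z * dslope V p z)) p := by
    refine hN.div (hU.mul (analyticAt_dslope' hV)) ?_
    rw [hdV]; exact mul_ne_zero hU0 hV'
  refine ⟨dslope (fun z => N z / (U z * dslope V p z)) p, analyticAt_dslope' hψ, ?_⟩
  have e0 := (hU.continuousAt.eventually_ne hU0).filter_mono (nhdsWithin_le_nhds (s := {p}ᶜ))
  filter_upwards [self_mem_nhdsWithin, e0] with z hz hUz
  have hz' : z - p ≠ 0 := sub_ne_zero.2 hz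
  rw [dslope_of_ne _ hz, slope_def_field, hdV, hc, dslope_of_ne _ hz, slope_def_field, hV0, sub_zero]
  have : c * (U p * V') / (U p * V') = c := by field_simp
  rw [this]
  by_cases hVz : V z = 0
  · simp [hVz]; ring
  · field_simp

lemma circle_zero {f : ℂ → ℂ} {R : ℝ} (hR : 0 ≤ R) (hm : MeromorphicOn f Set.univ)
    (h : ∀ z ∈ Metric.closedBall (0:ℂ) R, Reg f z)
    (hs : ∀ z ∈ Metric.sphere (0:ℂ) R, AnalyticAt ℂ f z) :
    ∮ z in C(0, R), f z = 0 := by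
  have hg : ∀ z ∈ Metric.closedBall (0:ℂ) R, AnalyticAt ℂ (toMeromorphicNFOn f Set.univ) z := by
    intro z hz
    obtain ⟨g, hg, hfg⟩ := h z hz
    have h0 : 0 ≤ meromorphicOrderAt f z := by
      rw [meromorphicOrderAt_congr hfg]; exact hg.meromorphicOrderAt_nonneg
    rw [(hm z trivial).meromorphicOrderAt_nonneg_iff_analyticAt_toMeromorphicNFAt] at h0
    exact h0.congr (toMeromorphicNFOn_eq_toMeromorphicNFAt_on_nhds hm trivial).symm
  have e : ∮ z in C(0, R), f z = ∮ z in C(0, R), toMeromorphicNFOn f Set.univ z := by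
    apply circleIntegral.integral_congr hR
    intro z hz
    have := (toMeromorphicNFOn_eq_toMeromorphicNFAt_on_nhds hm (Set.mem_univ z)).eq_of_nhds
    rw [this, toMeromorphicNFAt_eq_self.2 (hs z hz).meromorphicNFAt]
  rw [e]
  refine Complex.circleIntegral_eq_zero_of_differentiable_on_off_countable hR Set.countable_empty
    (fun z hz => (hg z hz).continuousAt.continuousWithinAt)
    (fun z hz => (hg z (Metric.ball_subset_closedBall hz.1)).differentiableAt)

lemma reg_of_bdd {f : ℂ → ℂ} {p : ℂ} (hm : MeromorphicAt f p)
    (hb : f =O[nhdsWithin p {p}ᶜ] (fun _ => (1:ℂ))) : Reg f p := by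
  have h0 : 0 ≤ meromorphicOrderAt f p := by
    by_contra hlt
    push Not at hlt
    have ht := (tendsto_cobounded_iff_meromorphicOrderAt_neg hm).2 hlt
    rw [← tendsto_norm_atTop_iff_cobounded] at ht
    obtain ⟨C, hC⟩ := hb.bound
    obtain ⟨z, h1, h2⟩ := (hC.and (ht.eventually_gt_atTop C)).exists
    simp at h1
    linarith
  rw [hm.meromorphicOrderAt_nonneg_iff_analyticAt_toMeromorphicNFAt] at h0
  exact ⟨_, h0, hm.eq_nhdsNE_toMeromorphicNFAt⟩

open Asymptotics Filter Topology in
lemma reg_zero (x q : ℝ) (hq : q ≠ 0) :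
    Reg (fun w : ℂ => Complex.sin (π * x * w) / (w ^ 2 * Complex.sin (π * q * w) * Complex.sin (π * w))
      - ((x / (π * q) : ℝ) / w ^ 3 + ((x * π * (q ^ 2 + 1 - x ^ 2) / (6 * q) : ℝ) : ℂ) / w)) 0 := by
  set A : ℂ := ((x / (π * q) : ℝ) : ℂ) with hA
  set B : ℂ := ((x * π * (q ^ 2 + 1 - x ^ 2) / (6 * q) : ℝ) : ℂ) with hB
  have hπ : (π : ℂ) ≠ 0 := by exact_mod_cast pi_ne_zero
  have hq' : (q : ℂ) ≠ 0 := by exact_mod_cast hq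
  have hπq : (π * q : ℂ) ≠ 0 := mul_ne_zero hπ hq'
  apply reg_of_bdd
  · fun_prop
  have hE : ∀ a : ℂ, (fun w : ℂ => Complex.sin (a * w) - (a * w - (a * w) ^ 3 / 6)) =O[𝓝[≠] 0]
      (fun w => w ^ 4) := by
    intro a
    have h1 : ∀ᶠ w : ℂ in 𝓝 0, ‖a * w‖ ≤ 1 := by
      have : ContinuousAt (fun w : ℂ => ‖a * w‖) 0 := by fun_prop
      exact (this.tendsto.eventually (Iio_mem_nhds (by simp))).mono fun w hw => le_of_lt hw
    have h2 : ∀ᶠ w : ℂ in 𝓝 0, ‖w‖ ≤ 1 := by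
      have : ContinuousAt (fun w : ℂ => ‖w‖) 0 := by fun_prop
      exact (this.tendsto.eventually (Iio_mem_nhds (by simp))).mono fun w hw => le_of_lt hw
    apply IsBigO.of_bound (‖a‖ ^ 5 / 100)
    filter_upwards [h1.filter_mono nhdsWithin_le_nhds, h2.filter_mono nhdsWithin_le_nhds] with w hw hw2
    refine (Complex.sin_bound hw).trans ?_
    rw [norm_mul, mul_pow, norm_pow]
    have : ‖w‖ ^ 5 ≤ ‖w‖ ^ 4 := pow_le_pow_of_le_one (norm_nonneg _) hw2 (by norm_num)
    have := mul_le_mul_of_nonneg_left this (pow_nonneg (norm_nonneg a) 5)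
    linarith
  have hO : ∀ g : ℂ → ℂ, ContinuousAt g 0 → g =O[𝓝[≠] 0] (fun _ => (1:ℂ)) := fun g hg =>
    (hg.tendsto.mono_left nhdsWithin_le_nhds).isBigO_one ℂ
  have hw1 : ∀ g : ℂ → ℂ, g =O[𝓝[≠] 0] (fun w => w ^ 1) → g =O[𝓝[≠] 0] (fun w => w) := by
    intro g hg; simpa using hg
  have hSw : ∀ a : ℂ, (fun w : ℂ => Complex.sin (a * w)) =O[𝓝[≠] 0] (fun w => w) := by
    intro a
    have hd : HasDerivAt (fun w : ℂ => Complex.sin (a * w)) (Complex.cos (a * 0) * (a * 1)) 0 :=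
      ((hasDerivAt_id (0:ℂ)).const_mul a).csin
    have := hd.isBigO_sub
    simp only [mul_zero, Complex.sin_zero, sub_zero] at this
    exact this.mono nhdsWithin_le_nhds
  have hSinv : ∀ a : ℂ, a ≠ 0 → (fun w : ℂ => w / Complex.sin (a * w)) =O[𝓝[≠] 0] (fun _ => (1:ℂ)) := by
    intro a ha
    have hd : HasDerivAt (fun w : ℂ => Complex.sin (a * w)) (Complex.cos (a * 0) * (a * 1)) 0 :=
      ((hasDerivAt_id (0:ℂ)).const_mul a).csin
    rw [hasDerivAt_iff_tendsto_slope_zero] at hd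
    simp at hd
    have := (hd.inv₀ ha).isBigO_one ℂ
    refine this.congr_left ?_
    intro w; simp [div_eq_mul_inv, mul_comm]
  set Nn : ℂ → ℂ := fun w => w * Complex.sin (π * x * w)
    - (A + B * w ^ 2) * (Complex.sin (π * q * w) * Complex.sin (π * w)) with hNn
  have hNO : Nn =O[𝓝[≠] 0] (fun w => w ^ 5) := by
    have t1 : (fun w : ℂ => w * (Complex.sin (π * x * w) - (π * x * w - (π * x * w) ^ 3 / 6)))
        =O[𝓝[≠] 0] (fun w => w ^ 5) :=
      ((isBigO_refl (fun w : ℂ => w) _).mul (hE (π * x))).congr_right fun w => by ring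
    have t2 : (fun w : ℂ => (A + B * w ^ 2) * ((Complex.sin (π * q * w) - (π * q * w - (π * q * w) ^ 3 / 6))
        * Complex.sin (π * w))) =O[𝓝[≠] 0] (fun w => w ^ 5) :=
      ((hO (fun w => A + B * w ^ 2) (by fun_prop)).mul ((hE (π * q)).mul (hSw π))).congr_right fun w => by ring
    have t3 : (fun w : ℂ => ((A + B * w ^ 2) * (π * q - (π * q) ^ 3 * w ^ 2 / 6)) *
        (w * (Complex.sin (π * w) - (π * w - (π * w) ^ 3 / 6)))) =O[𝓝[≠] 0] (fun w => w ^ 5) :=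
      ((hO (fun w => (A + B * w ^ 2) * (π * q - (π * q) ^ 3 * w ^ 2 / 6)) (by fun_prop)).mul
        ((isBigO_refl (fun w : ℂ => w) _).mul (hE π))).congr_right fun w => by ring
    have t4 : (fun w : ℂ => (w * (B * (π * q) * (π ^ 3 / 6) + B * (π * q) ^ 3 / 6 * π
        - A * ((π * q) ^ 3 / 6) * (π ^ 3 / 6) - w ^ 2 * B * ((π * q) ^ 3 / 6) * (π ^ 3 / 6))) * w ^ 5)
         =O[𝓝[≠] 0] (fun w => w ^ 5) :=
      ((hO (fun w => (w * (B * (π * q) * (π ^ 3 / 6) + B * (π * q) ^ 3 / 6 * π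
        - A * ((π * q) ^ 3 / 6) * (π ^ 3 / 6) - w ^ 2 * B * ((π * q) ^ 3 / 6) * (π ^ 3 / 6))))
        (by fun_prop)).mul (isBigO_refl (fun w : ℂ => w ^ 5) _)).congr_right fun w => by ring
    refine (((t1.sub t2).sub t3).add t4).congr_left ?_
    intro w
    have hA' : A * (π * q) * π = π * x := by
      rw [hA]; push_cast; field_simp
    have hB' : B * (π * q) * π = (π * x) * π ^ 2 * (q ^ 2 + 1 - x ^ 2) / 6 := by
      rw [hB]; push_cast; field_simp
    simp only [hNn]
    linear_combination (w ^ 2 - w ^ 4 * π ^ 2 * (q ^ 2 + 1) / 6) * hA' + w ^ 4 * hB'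
  have hfin := ((hNO.mul (isBigO_refl (fun w : ℂ => (w ^ 5)⁻¹) (𝓝[≠] 0))).mul
    (hSinv _ hπq)).mul (hSinv _ hπ)
  refine (hfin.congr' ?_ (g₂ := fun w : ℂ => (1:ℂ)) ?_)
  · have s1 : ∀ a : ℂ, a ≠ 0 → ∀ᶠ w : ℂ in 𝓝[≠] 0, Complex.sin (a * w) ≠ 0 := by
      intro a ha
      have hd : HasDerivAt (fun w : ℂ => Complex.sin (a * w)) (Complex.cos (a * 0) * (a * 1)) 0 :=
        ((hasDerivAt_id (0:ℂ)).const_mul a).csin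
      exact hd.eventually_ne (by simpa using ha)
    filter_upwards [s1 _ hπq, s1 _ hπ, self_mem_nhdsWithin] with w h1 h2 h3
    have h3 : w ≠ 0 := h3
    simp only [hNn]
    generalize Complex.sin (π * q * w) = u at *
    generalize Complex.sin (π * w) = v at *
    field_simp
    try ring
  · filter_upwards [self_mem_nhdsWithin] with w h3
    have h3 : w ≠ 0 := h3
    field_simp


noncomputable def FF (x q : ℝ) (w : ℂ) : ℂ :=
  Complex.sin (π * x * w) / (w ^ 2 * Complex.sin (π * q * w) * Complex.sin (π * w))

noncomputable def sec2 (x : ℝ) (n : ℤ) : ℝ := 1 / cos (π * n * x) / (n:ℝ) ^ 2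

lemma cos_ne_of_irr {x : ℝ} (hx : Irrational x) (n : ℤ) : cos (π * n * x) ≠ 0 := by
  intro h
  rw [Real.cos_eq_zero_iff] at h
  obtain ⟨k, hk⟩ := h
  have h1 : (n:ℝ) * x = (2 * k + 1) / 2 := by
    have : π * (n * x) = π * ((2 * k + 1) / 2) := by linarith
    exact mul_left_cancel₀ pi_ne_zero this
  by_cases hn : n = 0
  · subst hn; simp at h1
    have : (2 * k + 1 : ℤ) = 0 := by
      have : (2 * k + 1 : ℝ) = 0 := by linarith
      exact_mod_cast this
    omega
  · exact (irrational_iff_ne_rational _).1 (hx.intCast_mul hn) (2 * k + 1) 2 two_ne_zero (by push_cast; exact h1)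

lemma sin_ne_of_irr {x : ℝ} (hx : Irrational x) (n : ℤ) (hn : n ≠ 0) : sin (π * n * x) ≠ 0 := by
  intro h
  rw [Real.sin_eq_zero_iff] at h
  obtain ⟨k, hk⟩ := h
  have h1 : (n:ℝ) * x = k := by
    have : π * (n * x) = π * k := by linarith
    exact mul_left_cancel₀ pi_ne_zero this
  exact (irrational_iff_ne_rational _).1 (hx.intCast_mul hn) k 1 one_ne_zero (by push_cast; rw [h1]; simp)

lemma cos_pi_int_sq (n : ℤ) : cos (π * n) ^ 2 = 1 := by
  have := Real.sin_sq_add_cos_sq (π * n)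
  rw [mul_comm π, Real.sin_int_mul_pi] at this
  rw [mul_comm π]; linarith

lemma reg_int {x : ℝ} (hx : Irrational x) (n : ℤ) (hn : n ≠ 0) :
    Reg (fun w => FF x (1 + 2 * x) w - ((sec2 x n / (2 * π) : ℝ) : ℂ) / (w - n)) n := by
  have hq : Irrational (1 + 2 * x) := by
    have := (hx.intCast_mul (m := 2) two_ne_zero).intCast_add 1
    simpa using this
  have hs0 : sin (π * n) = 0 := by rw [mul_comm]; exact Real.sin_int_mul_pi n
  have hc2 := cos_pi_int_sq n
  have hcx := cos_ne_of_irr hx n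
  have hsq := sin_ne_of_irr hq n hn
  have hnR : (n:ℝ) ≠ 0 := by exact_mod_cast hn
  have hc0 : cos (π * n) ≠ 0 := by intro h; rw [h] at hc2; norm_num at hc2
  unfold FF
  refine reg_simple_pole (V' := ((cos (π * n) * π : ℝ) : ℂ)) (N := fun w => Complex.sin (π * x * w))
    (U := fun w => w ^ 2 * Complex.sin (π * ((1 + 2 * x : ℝ):ℂ) * w)) (V := fun w => Complex.sin (π * w))
    (by fun_prop) (by fun_prop) (by fun_prop) ?_ ?_ ?_ ?_ ?_
  · have : ((n:ℝ) ^ 2 * sin (π * n * (1 + 2 * x))) ≠ 0 := mul_ne_zero (pow_ne_zero _ hnR) hsq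
    rw [mul_right_comm] at this
    exact_mod_cast this
  · exact_mod_cast hs0
  · have := ((hasDerivAt_id ((n:ℂ))).const_mul (π:ℂ)).csin
    simpa using this
  · exact_mod_cast mul_ne_zero hc0 pi_ne_zero
  · have key : sin (π * x * n) = sec2 x n / (2 * π) * ((n:ℝ) ^ 2 * sin (π * (1 + 2 * x) * n) * (cos (π * n) * π)) := by
      have e : sin (π * (1 + 2 * x) * n) = cos (π * n) * (2 * sin (π * n * x) * cos (π * n * x)) := by
        have : π * (1 + 2 * x) * n = π * n + 2 * (π * n * x) := by ring
        rw [this, Real.sin_add, hs0, Real.sin_two_mul]; ring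
      rw [e, sec2, mul_right_comm π x]
      have hpi := pi_ne_zero
      generalize cos (π * n * x) = C at *
      field_simp
      linear_combination (-sin (π * n * x)) * hc2
    exact_mod_cast key

lemma reg_intq {x : ℝ} (hx : Irrational x) (n : ℤ) (hn : n ≠ 0) :
    Reg (fun w => FF x (1 + 2 * x) w - ((-(1 + 2 * x) * sec2 (x / (1 + 2 * x)) n / (2 * π) : ℝ) : ℂ)
      / (w - (n / (1 + 2 * x) : ℝ))) ((n / (1 + 2 * x) : ℝ) : ℂ) := by
  have hq : Irrational (1 + 2 * x) := by
    have := (hx.intCast_mul (m := 2) two_ne_zero).intCast_add 1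
    simpa using this
  have hqi := hq.inv
  have hq0 : 1 + 2 * x ≠ 0 := hq.ne_zero
  have hy : Irrational (x / (1 + 2 * x)) := by
    have h1 := (hqi.intCast_sub 1).div_intCast (m := 2) two_ne_zero
    have : x / (1 + 2 * x) = (((1:ℤ):ℝ) - (1 + 2 * x)⁻¹) / ((2:ℤ):ℝ) := by
      have h2 := mul_inv_cancel₀ hq0
      rw [div_eq_mul_inv x]; push_cast; linear_combination h2 / 2
    rwa [this]
  have hs0 : sin (π * n) = 0 := by rw [mul_comm]; exact Real.sin_int_mul_pi n
  have hc2 := cos_pi_int_sq n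
  have hcx := cos_ne_of_irr hy n
  have hsq := sin_ne_of_irr hqi n hn
  have hnR : (n:ℝ) ≠ 0 := by exact_mod_cast hn
  have hc0 : cos (π * n) ≠ 0 := by intro h; rw [h] at hc2; norm_num at hc2
  have hF : (fun w => FF x (1 + 2 * x) w - ((-(1 + 2 * x) * sec2 (x / (1 + 2 * x)) n / (2 * π) : ℝ) : ℂ)
      / (w - (n / (1 + 2 * x) : ℝ))) = (fun w => Complex.sin (π * x * w) / ((w ^ 2 * Complex.sin (π * w)) * Complex.sin (π * ((1 + 2 * x : ℝ):ℂ) * w))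
      - ((-(1 + 2 * x) * sec2 (x / (1 + 2 * x)) n / (2 * π) : ℝ) : ℂ)
      / (w - (n / (1 + 2 * x) : ℝ))) := by
    funext w; rw [FF, mul_right_comm (w ^ 2)]
  rw [hF]
  refine reg_simple_pole (V' := ((cos (π * n) * (π * (1 + 2 * x)) : ℝ) : ℂ)) (N := fun w => Complex.sin (π * x * w))
    (V := fun w => Complex.sin (π * ((1 + 2 * x : ℝ):ℂ) * w)) (U := fun w => w ^ 2 * Complex.sin (π * w))
    (by fun_prop) (by fun_prop) (by fun_prop) ?_ ?_ ?_ ?_ ?_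
  · have : ((n / (1 + 2 * x)) ^ 2 * sin (π * (n / (1 + 2 * x)))) ≠ 0 := by
      rw [← div_eq_mul_inv, mul_div_assoc] at hsq
      exact mul_ne_zero (pow_ne_zero _ (div_ne_zero hnR hq0)) hsq
    exact_mod_cast this
  · have : sin (π * (1 + 2 * x) * (n / (1 + 2 * x))) = 0 := by
      rw [← hs0]; congr 1; field_simp
    exact_mod_cast this
  · have := ((hasDerivAt_id (((n / (1 + 2 * x) : ℝ) : ℂ))).const_mul (π * ((1 + 2 * x : ℝ):ℂ))).csin
    have e : Complex.cos (π * ((1 + 2 * x : ℝ):ℂ) * ((n / (1 + 2 * x) : ℝ) : ℂ)) = ((cos (π * n) : ℝ):ℂ) := by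
      have : π * n = π * (1 + 2 * x) * (n / (1 + 2 * x)) := by field_simp
      rw [this]; push_cast; rfl
    simp only [id] at this
    rw [e, mul_one] at this
    push_cast at this ⊢
    exact this
  · exact_mod_cast mul_ne_zero hc0 (mul_ne_zero pi_ne_zero hq0)
  · have key : sin (π * x * (n / (1 + 2 * x))) = -(1 + 2 * x) * sec2 (x / (1 + 2 * x)) n / (2 * π) *
        ((n / (1 + 2 * x)) ^ 2 * sin (π * (n / (1 + 2 * x))) * (cos (π * n) * (π * (1 + 2 * x)))) := by
      have e : sin (π * (n / (1 + 2 * x))) = - (cos (π * n) * (2 * sin (π * n * (x / (1 + 2 * x))) * cos (π * n * (x / (1 + 2 * x))))) := by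
        have : π * (n / (1 + 2 * x)) = π * n - 2 * (π * n * (x / (1 + 2 * x))) := by field_simp; ring
        rw [this, Real.sin_sub, hs0, Real.sin_two_mul]; ring
      have e2 : π * x * (n / (1 + 2 * x)) = π * n * (x / (1 + 2 * x)) := by ring
      rw [e, sec2, e2]
      have hpi := pi_ne_zero
      generalize cos (π * n * (x / (1 + 2 * x))) = C at *
      generalize sin (π * n * (x / (1 + 2 * x))) = S at *
      generalize cos (π * n) = E at *
      field_simp
      linear_combination (-S) * hc2
    exact_mod_cast key


lemma analytic_sum (I : Finset ℤ) (c p : ℤ → ℂ) (z : ℂ) (h : ∀ n ∈ I, c n = 0 ∨ z ≠ p n) :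
    AnalyticAt ℂ (fun w => ∑ n ∈ I, c n / (w - p n)) z := by
  apply Finset.analyticAt_fun_sum
  intro n hn
  rcases h n hn with h | h
  · simp only [h, zero_div]; exact analyticAt_const
  · exact analyticAt_const.div (by fun_prop) (sub_ne_zero.2 h)

lemma integral_sum (I : Finset ℤ) (c p : ℤ → ℂ) {R : ℝ} (hR : 0 < R) (h : ∀ n ∈ I, ‖p n‖ < R) :
    ∮ w in C(0, R), ∑ n ∈ I, c n / (w - p n) = 2 * π * Complex.I * ∑ n ∈ I, c n := by
  rw [circleIntegral.integral_fun_sum, Finset.mul_sum]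
  · apply Finset.sum_congr rfl
    intro n hn
    simp only [div_eq_mul_inv]
    rw [circleIntegral.integral_const_mul, circleIntegral.integral_sub_inv_of_mem_ball (by simpa using h n hn)]
    ring
  · intro n hn
    apply ContinuousOn.circleIntegrable hR.le
    apply ContinuousOn.div continuousOn_const (by fun_prop)
    intro z hz h0
    rw [sub_eq_zero] at h0
    have := h n hn
    rw [← h0] at this
    simp at hz; linarith

lemma FF_analytic {x q : ℝ} {z : ℂ} (h0 : z ≠ 0) (hq : q ≠ 0) (h1 : ∀ n : ℤ, z ≠ n)
    (h2 : ∀ n : ℤ, z ≠ ((n / q : ℝ) : ℂ)) : AnalyticAt ℂ (FF x q) z := by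
  unfold FF
  have hπ : (π : ℂ) ≠ 0 := by exact_mod_cast pi_ne_zero
  have hq' : (q : ℂ) ≠ 0 := by exact_mod_cast hq
  refine AnalyticAt.div (by fun_prop) (by fun_prop) ?_
  refine mul_ne_zero (mul_ne_zero (pow_ne_zero _ h0) ?_) ?_
  · intro h
    rw [Complex.sin_eq_zero_iff] at h
    obtain ⟨k, hk⟩ := h
    apply h2 k
    push_cast
    rw [eq_div_iff hq']
    apply mul_left_cancel₀ hπ
    linear_combination hk
  · intro h
    rw [Complex.sin_eq_zero_iff] at h
    obtain ⟨k, hk⟩ := h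
    apply h1 k
    apply mul_left_cancel₀ hπ
    linear_combination hk

lemma circle_res {x : ℝ} (hx : Irrational x) {R : ℝ} (hR : 0 < R)
    (hR1 : ∀ n : ℤ, |(n:ℝ)| ≠ R) (hR2 : ∀ n : ℤ, |(n / (1 + 2 * x) : ℝ)| ≠ R) (I J : Finset ℤ)
    (hI : ∀ n : ℤ, n ∈ I ↔ |(n:ℝ)| < R) (hJ : ∀ n : ℤ, n ∈ J ↔ |(n / (1 + 2 * x) : ℝ)| < R) :
    ∮ w in C(0, R), FF x (1 + 2 * x) w = 2 * π * Complex.I *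
      ((∑ n ∈ I, sec2 x n / (2 * π) + ∑ n ∈ J, -(1 + 2 * x) * sec2 (x / (1 + 2 * x)) n / (2 * π)
        + x * π * ((1 + 2 * x) ^ 2 + 1 - x ^ 2) / (6 * (1 + 2 * x)) : ℝ) : ℂ) := by
  have hq : Irrational (1 + 2 * x) := by
    have := (hx.intCast_mul (m := 2) two_ne_zero).intCast_add 1
    simpa using this
  have h0 := reg_zero x (1 + 2 * x) hq.ne_zero
  have hi := reg_int hx
  have hj := reg_intq hx
  change Reg (fun w => FF x (1 + 2 * x) w - _) 0 at h0
  set q := 1 + 2 * x with hqd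
  set c : ℤ → ℂ := fun n => ((sec2 x n / (2 * π) : ℝ) : ℂ) with hc
  set d : ℤ → ℂ := fun n => ((-q * sec2 (x / q) n / (2 * π) : ℝ) : ℂ) with hd
  set A : ℂ := ((x / (π * q) : ℝ) : ℂ)
  set B : ℂ := ((x * π * (q ^ 2 + 1 - x ^ 2) / (6 * q) : ℝ) : ℂ) with hB
  set p : ℤ → ℂ := fun n => ((n / q : ℝ) : ℂ) with hp
  have hc0 : c 0 = 0 := by simp [hc, sec2]
  have hd0 : d 0 = 0 := by simp [hd, sec2]
  have hq0 : q ≠ 0 := hq.ne_zero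
  have npi : ∀ n : ℤ, ‖(n:ℂ)‖ = |(n:ℝ)| := fun n => by simp
  have npj : ∀ n : ℤ, ‖p n‖ = |(n/q:ℝ)| := fun n => by simp only [hp]; rw [Complex.norm_real, Real.norm_eq_abs]
  have hpne : ∀ n m : ℤ, n ≠ 0 → (n:ℂ) ≠ p m := by
    intro n m hn h
    have h1 : (n:ℝ) = m / q := by simp only [hp] at h; exact_mod_cast h
    rw [eq_div_iff hq0] at h1
    exact (irrational_iff_ne_rational _).1 (hq.intCast_mul hn) m 1 one_ne_zero (by simpa using h1)
  have hinj : ∀ n m : ℤ, p n = p m → n = m := by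
    intro n m h
    have h1 : (n:ℝ) / q = m / q := by simp only [hp] at h; exact_mod_cast h
    field_simp at h1
    exact_mod_cast h1
  set P1 : ℂ → ℂ := fun w => ∑ n ∈ I, c n / (w - n) with hP1
  set P2 : ℂ → ℂ := fun w => ∑ n ∈ J, d n / (w - p n) with hP2
  set P3 : ℂ → ℂ := fun w => A / w ^ 3 + B / w with hP3
  have a1 : ∀ z : ℂ, (∀ n : ℤ, n ≠ 0 → z ≠ n) → AnalyticAt ℂ P1 z := by
    intro z hz
    refine analytic_sum I c (fun n => n) z fun n _ => ?_
    by_cases h : n = 0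
    · left; rw [h, hc0]
    · right; exact hz n h
  have a2 : ∀ z : ℂ, (∀ n : ℤ, n ≠ 0 → z ≠ p n) → AnalyticAt ℂ P2 z := by
    intro z hz
    refine analytic_sum J d p z fun n _ => ?_
    by_cases h : n = 0
    · left; rw [h, hd0]
    · right; exact hz n h
  have a3 : ∀ z : ℂ, z ≠ 0 → AnalyticAt ℂ P3 z := by
    intro z hz
    have cA : AnalyticAt ℂ (fun w => A / w ^ 3) z :=
      analyticAt_const.div (by fun_prop) (pow_ne_zero _ hz)
    have cB : AnalyticAt ℂ (fun w => B / w) z := analyticAt_const.div (by fun_prop) hz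
    exact cA.add cB
  have p0 : p 0 = 0 := by simp [hp]
  have hsph : ∀ z ∈ Metric.sphere (0:ℂ) R, z ≠ 0 ∧ (∀ n : ℤ, z ≠ n) ∧ (∀ n : ℤ, z ≠ p n) := by
    intro z hz
    simp at hz
    refine ⟨?_, ?_, ?_⟩
    · rintro rfl; simp at hz; linarith
    · rintro n rfl; rw [npi] at hz; exact hR1 n hz
    · rintro n rfl; rw [npj] at hz; exact hR2 n hz
  have hFs : ∀ z ∈ Metric.sphere (0:ℂ) R, AnalyticAt ℂ (FF x q) z := fun z hz =>
    FF_analytic (hsph z hz).1 hq0 (hsph z hz).2.1 (hsph z hz).2.2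
  have hPs1 : ∀ z ∈ Metric.sphere (0:ℂ) R, AnalyticAt ℂ P1 z := fun z hz =>
    a1 z fun n _ => (hsph z hz).2.1 n
  have hPs2 : ∀ z ∈ Metric.sphere (0:ℂ) R, AnalyticAt ℂ P2 z := fun z hz =>
    a2 z fun n _ => (hsph z hz).2.2 n
  have hPs3 : ∀ z ∈ Metric.sphere (0:ℂ) R, AnalyticAt ℂ P3 z := fun z hz => a3 z (hsph z hz).1
  have hci : ∀ f : ℂ → ℂ, (∀ z ∈ Metric.sphere (0:ℂ) R, AnalyticAt ℂ f z) → CircleIntegrable f 0 R :=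
    fun f hf => ContinuousOn.circleIntegrable hR.le fun z hz => (hf z hz).continuousAt.continuousWithinAt
  have hzero : ∮ w in C(0, R), (FF x q w - (P1 w + P2 w + P3 w)) = 0 := by
    apply circle_zero hR.le
    · intro z _
      have : MeromorphicAt (FF x q) z := by unfold FF; fun_prop
      have m1 : MeromorphicAt P1 z := by simp only [hP1]; fun_prop
      have m2 : MeromorphicAt P2 z := by simp only [hP2]; fun_prop
      have m3 : MeromorphicAt P3 z := by simp only [hP3]; fun_prop
      exact this.sub ((m1.add m2).add m3)
    · intro z hz
      have hz' : ‖z‖ ≤ R := by simpa using hz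
      by_cases z0 : z = 0
      · subst z0
        have e1 := a1 0 (fun n hn h => hn (by exact_mod_cast h.symm))
        have e2 := a2 0 (fun n hn h => hn (hinj n 0 (by rw [p0, h])))
        have := h0.add (e1.add e2).neg.reg
        refine cast (congrArg (Reg · 0) ?_) this
        funext w; simp only [hP3, Pi.neg_apply, Pi.add_apply]; ring
      by_cases z1 : ∃ n : ℤ, z = n
      · obtain ⟨n, rfl⟩ := z1
        have hn : n ≠ 0 := by rintro rfl; simp at z0
        have hnI : n ∈ I := by
          rw [hI]; rw [npi] at hz'; exact lt_of_le_of_ne hz' (hR1 n)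
        have e1 := analytic_sum (I.erase n) c (fun m => m) n (fun m hm => Or.inr (by
          have := (Finset.mem_erase.1 hm).1
          intro h; exact this (by exact_mod_cast h.symm)))
        have e2 := a2 n (fun m _ => hpne n m hn)
        have e3 := a3 n z0
        have := (hi n hn).add ((e1.add e2).add e3).neg.reg
        refine cast (congrArg (Reg · (n:ℂ)) ?_) this
        funext w
        simp only [hP1, Pi.neg_apply, Pi.add_apply]
        rw [← Finset.add_sum_erase I _ hnI]; ring
      by_cases z2 : ∃ n : ℤ, z = p n
      · obtain ⟨n, rfl⟩ := z2
        have hn : n ≠ 0 := by rintro rfl; exact z0 p0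
        have hnJ : n ∈ J := by
          rw [hJ]; rw [npj] at hz'; exact lt_of_le_of_ne hz' (hR2 n)
        have e2 := analytic_sum (J.erase n) d p (p n) (fun m hm => Or.inr (by
          have := (Finset.mem_erase.1 hm).1
          intro h; exact this (hinj _ _ h.symm)))
        have e1 := a1 (p n) (fun m hm h => hpne m n hm h.symm)
        have e3 := a3 (p n) z0
        have := (hj n hn).add ((e1.add e2).add e3).neg.reg
        refine cast (congrArg (Reg · (p n)) ?_) this
        funext w
        simp only [hP2, Pi.neg_apply, Pi.add_apply]
        rw [← Finset.add_sum_erase J _ hnJ]; ring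
      · push Not at z1 z2
        exact ((FF_analytic z0 hq0 z1 z2).sub (((a1 z fun n _ => z1 n).add (a2 z fun n _ => z2 n)).add (a3 z z0))).reg
    · intro z hz
      exact (hFs z hz).sub (((hPs1 z hz).add (hPs2 z hz)).add (hPs3 z hz))
  rw [circleIntegral.integral_sub (hci _ hFs) (hci (fun w => P1 w + P2 w + P3 w) fun z hz => ((hPs1 z hz).add (hPs2 z hz)).add (hPs3 z hz)),
    circleIntegral.integral_add (hci (fun w => P1 w + P2 w) fun z hz => (hPs1 z hz).add (hPs2 z hz)) (hci _ hPs3),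
    circleIntegral.integral_add (hci _ hPs1) (hci _ hPs2), sub_eq_zero] at hzero
  rw [hzero]
  have i1 : ∮ w in C(0, R), P1 w = 2 * π * Complex.I * ∑ n ∈ I, c n :=
    integral_sum I c (fun n => n) hR (fun n hn => by rw [npi]; exact (hI n).1 hn)
  have i2 : ∮ w in C(0, R), P2 w = 2 * π * Complex.I * ∑ n ∈ J, d n :=
    integral_sum J d p hR (fun n hn => by rw [npj]; exact (hJ n).1 hn)
  have i3 : ∮ w in C(0, R), P3 w = 2 * π * Complex.I * B := by
    have cA : ∀ z ∈ Metric.sphere (0:ℂ) R, AnalyticAt ℂ (fun w => A / w ^ 3) z := fun z hz =>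
      analyticAt_const.div (by fun_prop) (pow_ne_zero _ (hsph z hz).1)
    have cB : ∀ z ∈ Metric.sphere (0:ℂ) R, AnalyticAt ℂ (fun w => B / w) z := fun z hz =>
      analyticAt_const.div (by fun_prop) (hsph z hz).1
    simp only [hP3]
    rw [circleIntegral.integral_add (hci _ cA) (hci _ cB)]
    simp only [div_eq_mul_inv]
    rw [circleIntegral.integral_const_mul, circleIntegral.integral_const_mul]
    have j1 := circleIntegral.integral_sub_zpow_of_ne (n := -3) (by norm_num) 0 0 R
    have j2 := circleIntegral.integral_sub_inv_of_mem_ball (c := 0) (w := 0) (R := R) (by simpa using hR)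
    simp only [sub_zero] at j1 j2
    have j1' : ∮ w in C(0, R), (w ^ 3)⁻¹ = 0 := by
      rw [← j1]; congr 1
    rw [j1', j2]; ring
  rw [i1, i2, i3]
  simp only [hc, hd, hB]
  push_cast
  ring


lemma le_of_sq_le_sq' {a b : ℝ} (h : a ^ 2 ≤ b ^ 2) (hb : 0 ≤ b) : a ≤ b :=
  (abs_le_of_sq_le_sq' h hb).2

lemma norm_sin_sq (z : ℂ) : ‖Complex.sin z‖ ^ 2 = sin z.re ^ 2 + sinh z.im ^ 2 := by
  have h : Complex.sin z = ((sin z.re * cosh z.im : ℝ) : ℂ) + ((cos z.re * sinh z.im : ℝ) : ℂ) * Complex.I := by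
    rw [Complex.sin_eq]; push_cast; ring
  rw [← Complex.normSq_eq_norm_sq, h, Complex.normSq_add_mul_I]
  have h1 := Real.cosh_sq z.im
  have h2 := Real.sin_sq_add_cos_sq z.re
  rw [mul_pow, mul_pow, h1]
  linear_combination (sinh z.im ^ 2) * h2

lemma norm_sin_ge1 (z : ℂ) : |sin z.re| ≤ ‖Complex.sin z‖ := by
  refine abs_le_of_sq_le_sq ?_ (norm_nonneg _)
  rw [norm_sin_sq]; nlinarith [sq_nonneg (sinh z.im)]

lemma norm_sin_ge2 (z : ℂ) (h : 1 ≤ |z.im|) : exp |z.im| / 4 ≤ ‖Complex.sin z‖ := by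
  have h1 : sinh |z.im| ≤ ‖Complex.sin z‖ := by
    refine le_of_sq_le_sq' ?_ (norm_nonneg _)
    rw [norm_sin_sq]
    have : sinh |z.im| ^ 2 = sinh z.im ^ 2 := by
      rcases abs_cases z.im with h | h <;> rw [h.1]
      rw [Real.sinh_neg]; ring
    rw [this]; nlinarith [sq_nonneg (sin z.re)]
  refine le_trans ?_ h1
  rw [Real.sinh_eq]
  have h2 : exp (-|z.im|) ≤ 1 := by rw [Real.exp_le_one_iff]; linarith
  have h3 : 2 ≤ exp |z.im| := by linarith [Real.add_one_le_exp |z.im|]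
  linarith

lemma norm_sin_le (z : ℂ) : ‖Complex.sin z‖ ≤ exp |z.im| := by
  have h1 : ‖Complex.sin z‖ ≤ cosh |z.im| := by
    refine le_of_sq_le_sq' ?_ (Real.cosh_pos _).le
    rw [norm_sin_sq, Real.cosh_abs, Real.cosh_sq]
    nlinarith [Real.sin_sq_le_one z.re]
  refine h1.trans ?_
  rw [Real.cosh_eq]
  have h2 : exp (-|z.im|) ≤ exp |z.im| := by rw [Real.exp_le_exp]; linarith [abs_nonneg z.im]
  linarith

lemma sin_low {a u R : ℝ} (hR : 0 < R) (hu : |u| ≤ R) (hu2 : R - |u| ≤ 1 / R)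
    (hs : 1 / 2 ≤ sin (π * a * R) ^ 2) (ha : 10 * (π * |a|) ≤ R) : 1 / 2 ≤ |sin (π * a * u)| := by
  have h1 : |sin (π * a * u)| = |sin (π * a * |u|)| := by
    rcases abs_cases u with h | h <;> rw [h.1]
    rw [mul_neg, Real.sin_neg, abs_neg]
  rw [h1]
  have h2 : |sin (π * a * R) - sin (π * a * |u|)| ≤ |π * a * R - π * a * (|u|)| := Real.abs_sin_sub_sin_le _ _
  have h3 : |π * a * R - π * a * (|u|)| ≤ 1 / 10 := by
    rw [← mul_sub, abs_mul, abs_mul, abs_of_pos pi_pos, abs_of_nonneg (by linarith : 0 ≤ R - |u|)]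
    have : π * |a| * (R - |u|) ≤ (R / 10) * (1 / R) := by
      apply mul_le_mul _ hu2 (by linarith) (by positivity)
      linarith
    refine this.trans (le_of_eq ?_)
    field_simp
  have h4 : 7 / 10 ≤ |sin (π * a * R)| := by
    refine le_of_sq_le_sq' ?_ (abs_nonneg _)
    rw [sq_abs]; linarith
  have := abs_sub_abs_le_abs_sub (sin (π * a * R)) (sin (π * a * |u|))
  linarith

lemma FF_bound {x R : ℝ} (hq : 1 ≤ |1 + 2 * x|) (hR : 10 * (π * |1 + 2 * x|) ≤ R)
    (h1 : 1 / 2 ≤ sin (π * R) ^ 2) (h2 : 1 / 2 ≤ sin (π * (1 + 2 * x) * R) ^ 2)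
    (w : ℂ) (hw : ‖w‖ = R) : ‖FF x (1 + 2 * x) w‖ ≤ 16 * exp (π * |x|) / R ^ 2 := by
  have hπ := Real.pi_gt_three
  have hR0 : 0 < R := by nlinarith
  have hxq : |x| ≤ 1 + |1 + 2 * x| := by
    rcases abs_cases x with h | h <;> rcases abs_cases (1 + 2 * x) with h' | h' <;> linarith
  set q := 1 + 2 * x
  have im1 : ((π : ℂ) * x * w).im = π * x * w.im := by
    rw [← Complex.ofReal_mul, Complex.im_ofReal_mul]
  have im2 : ((π : ℂ) * q * w).im = π * q * w.im := by
    rw [← Complex.ofReal_mul, Complex.im_ofReal_mul]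
  have re2 : ((π : ℂ) * q * w).re = π * q * w.re := by
    rw [← Complex.ofReal_mul, Complex.re_ofReal_mul]
  have im3 : ((π : ℂ) * w).im = π * w.im := Complex.im_ofReal_mul _ _
  have re3 : ((π : ℂ) * w).re = π * w.re := Complex.re_ofReal_mul _ _
  have hnum := norm_sin_le ((π : ℂ) * x * w)
  rw [im1, abs_mul, abs_mul, abs_of_pos pi_pos] at hnum
  have hsq : w.re ^ 2 + w.im ^ 2 = R ^ 2 := by
    rw [← hw, ← Complex.normSq_eq_norm_sq, Complex.normSq_apply]; ring
  have hFF : ‖FF x q w‖ = (‖Complex.sin (π * x * w)‖ / (‖Complex.sin (π * q * w)‖ * ‖Complex.sin (π * w)‖)) / R ^ 2 := by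
    rw [FF, norm_div, norm_mul, norm_mul, norm_pow, hw, div_div]; congr 1; ring
  rw [hFF]
  refine div_le_div_of_nonneg_right ?_ (by positivity)
  by_cases hv : 1 ≤ |w.im|
  · have hd2 := norm_sin_ge2 ((π : ℂ) * q * w) (by
      rw [im2, abs_mul, abs_mul, abs_of_pos pi_pos]
      have : 1 ≤ |q| * |w.im| := one_le_mul_of_one_le_of_one_le hq hv
      nlinarith)
    have hd3 := norm_sin_ge2 ((π : ℂ) * w) (by
      rw [im3, abs_mul, abs_of_pos pi_pos]; nlinarith)
    rw [im2, abs_mul, abs_mul, abs_of_pos pi_pos] at hd2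
    rw [im3, abs_mul, abs_of_pos pi_pos] at hd3
    have hdd := mul_le_mul hd2 hd3 (by positivity) (norm_nonneg _)
    have hpos : 0 < exp (π * |q| * |w.im|) / 4 * (exp (π * |w.im|) / 4) := by positivity
    rw [div_le_iff₀ (lt_of_lt_of_le hpos hdd)]
    refine hnum.trans ?_
    have e1 : exp (π * |x| * |w.im|) ≤ exp (π * |q| * |w.im|) * exp (π * |w.im|) := by
      rw [← Real.exp_add, Real.exp_le_exp]
      have := mul_le_mul_of_nonneg_right hxq (mul_nonneg pi_pos.le (abs_nonneg w.im))
      nlinarith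
    have e2 : 1 ≤ exp (π * |x|) := Real.one_le_exp (by positivity)
    have e3 := mul_le_mul_of_nonneg_left hdd (by norm_num : (0:ℝ) ≤ 16)
    have e4 : 0 ≤ ‖Complex.sin (π * q * w)‖ * ‖Complex.sin (π * w)‖ := by positivity
    nlinarith
  · push Not at hv
    have hre : |w.re| ≤ R := by rw [← hw]; exact Complex.abs_re_le_norm w
    have hv2 : w.im ^ 2 ≤ 1 := by rw [← sq_abs]; nlinarith [abs_nonneg w.im]
    have hre2 : R - |w.re| ≤ 1 / R := by
      rw [le_div_iff₀ hR0]
      have : w.re ^ 2 = |w.re| ^ 2 := (sq_abs _).symm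
      nlinarith [abs_nonneg w.re]
    have l1 := sin_low (a := q) hR0 hre hre2 h2 hR
    have l2 := sin_low (a := 1) hR0 hre hre2 (by simpa using h1) (by
      rw [abs_one]; nlinarith)
    rw [mul_one] at l2
    have g1 := norm_sin_ge1 ((π : ℂ) * q * w)
    have g2 := norm_sin_ge1 ((π : ℂ) * w)
    rw [re2] at g1
    rw [re3] at g2
    have hdd : (1/2:ℝ) * (1/2) ≤ ‖Complex.sin (π * q * w)‖ * ‖Complex.sin (π * w)‖ :=
      mul_le_mul (l1.trans g1) (l2.trans g2) (by norm_num) (norm_nonneg _)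
    rw [div_le_iff₀ (lt_of_lt_of_le (by norm_num) hdd)]
    have e1 : exp (π * |x| * |w.im|) ≤ exp (π * |x|) := by
      rw [Real.exp_le_exp]
      exact mul_le_of_le_one_right (by positivity) hv.le
    have : 0 < exp (π * |x|) := Real.exp_pos _
    nlinarith

lemma exists_R {q : ℝ} (hq : 1 ≤ |q|) (N : ℕ) : ∃ R : ℝ, (N:ℝ) ≤ R ∧
    1 / 2 ≤ sin (π * R) ^ 2 ∧ 1 / 2 ≤ sin (π * q * R) ^ 2 := by
  have hA : ∀ t : ℝ, 1 / 4 ≤ t → t ≤ 3 / 4 → 1 / 2 ≤ sin (π * (N + t)) ^ 2 := by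
    intro t h1 h2
    rw [Real.sin_sq_eq_half_sub]
    have e : 2 * (π * (N + t)) = 2 * π * t + N * (2 * π) := by ring
    rw [e, Real.cos_add_nat_mul_two_pi]
    have := Real.cos_nonpos_of_pi_div_two_le_of_le (x := 2 * π * t) (by nlinarith [pi_pos]) (by nlinarith [pi_pos])
    linarith
  have hq0 : 0 < |q| := by linarith
  have hsq : ∀ R, sin (π * q * R) ^ 2 = sin (π * |q| * R) ^ 2 := by
    intro R
    rcases abs_cases q with h | h <;> rw [h.1]
    have : π * -q * R = -(π * q * R) := by ring
    rw [this, Real.sin_neg]; ring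
  have hsum : sin (π * |q| * (N + (1 / 4 + 1 / (2 * |q|)))) = cos (π * |q| * (N + 1 / 4)) := by
    rw [← Real.sin_add_pi_div_two]; congr 1; field_simp; ring
  have hle : 1 / (2 * |q|) ≤ 1 / 2 := by
    apply one_div_le_one_div_of_le <;> linarith
  have hge : 0 < 1 / (2 * |q|) := by positivity
  have := Real.sin_sq_add_cos_sq (π * |q| * (N + 1 / 4))
  by_cases h : 1 / 2 ≤ sin (π * |q| * (N + 1 / 4)) ^ 2
  · exact ⟨N + 1 / 4, by linarith, hA _ (by norm_num) (by norm_num), by rw [hsq]; exact h⟩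
  · refine ⟨N + (1 / 4 + 1 / (2 * |q|)), by linarith, hA _ (by linarith) (by linarith), ?_⟩
    rw [hsq, hsum]; linarith


open Filter Topology in
lemma sum_value {x : ℝ} {j : ℤ} (hx : Irrational x) (hxj : x ^ 2 = 4 * j * x + 2 * j)
    (hq : 1 ≤ |1 + 2 * x|) (hs : Summable (sec2 x)) :
    ∑' n : ℤ, sec2 x n = (3 * (j:ℝ) + 1) * π ^ 2 / 3 := by
  have hq0 : 1 + 2 * x ≠ 0 := by intro h; rw [h] at hq; norm_num at hq
  have hqpos : 0 < |1 + 2 * x| := by linarith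
  have hsx : sec2 (x / (1 + 2 * x)) = sec2 x := by
    funext n
    have e : x / (1 + 2 * x) = x - 4 * j := by
      rw [div_eq_iff hq0]; linear_combination (-2) * hxj
    have e2 : π * n * (x - 4 * j) = π * n * x - ((2 * j * n : ℤ) : ℝ) * (2 * π) := by push_cast; ring
    rw [sec2, sec2, e, e2, Real.cos_sub_int_mul_two_pi]
  choose R hRN hR1 hR2 using exists_R hq
  have hRtop : Tendsto R atTop atTop := tendsto_atTop_mono hRN tendsto_natCast_atTop_atTop
  let I : ℕ → Finset ℤ := fun N => Finset.Icc (-⌊R N⌋) ⌊R N⌋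
  let J : ℕ → Finset ℤ := fun N => Finset.Icc (-⌊R N * |1 + 2 * x|⌋) ⌊R N * |1 + 2 * x|⌋
  have hI : Tendsto I atTop atTop :=
    Finset.tendsto_Icc_neg_atTop_atTop.comp (tendsto_floor_atTop.comp hRtop)
  have hJ : Tendsto J atTop atTop :=
    Finset.tendsto_Icc_neg_atTop_atTop.comp (tendsto_floor_atTop.comp (hRtop.atTop_mul_const hqpos))
  set S := ∑' n : ℤ, sec2 x n with hS
  have hIS : Tendsto (fun N => ∑ n ∈ I N, sec2 x n) atTop (𝓝 S) := hs.hasSum.comp hI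
  have hJS : Tendsto (fun N => ∑ n ∈ J N, sec2 x n) atTop (𝓝 S) := hs.hasSum.comp hJ
  set B := x * π * ((1 + 2 * x) ^ 2 + 1 - x ^ 2) / (6 * (1 + 2 * x)) with hB
  let T : ℕ → ℝ := fun N => ∑ n ∈ I N, sec2 x n / (2 * π) +
    ∑ n ∈ J N, -(1 + 2 * x) * sec2 (x / (1 + 2 * x)) n / (2 * π) + B
  have hT1 : Tendsto T atTop (𝓝 (S / (2 * π) + -(1 + 2 * x) * S / (2 * π) + B)) := by
    have e : T = fun N => (∑ n ∈ I N, sec2 x n) / (2 * π) +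
        -(1 + 2 * x) * (∑ n ∈ J N, sec2 x n) / (2 * π) + B := by
      funext N
      simp only [T]
      rw [hsx, Finset.sum_div, Finset.mul_sum, Finset.sum_div]
    rw [e]
    exact ((hIS.div_const _).add ((hJS.const_mul _).div_const _)).add_const _
  have hmem : ∀ (r : ℝ) (n : ℤ), n ∈ Finset.Icc (-⌊r⌋) ⌊r⌋ ↔ |(n:ℝ)| ≤ r := by
    intro r n
    rw [Finset.mem_Icc, ← abs_le, Int.le_floor, Int.cast_abs]
  have hT2 : Tendsto T atTop (𝓝 0) := by
    have hlim : Tendsto (fun N => 16 * exp (π * |x|) / R N) atTop (𝓝 0) :=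
      tendsto_const_nhds.div_atTop hRtop
    refine squeeze_zero_norm' ?_ hlim
    filter_upwards [hRtop.eventually_ge_atTop (10 * (π * |1 + 2 * x|))] with N hN
    have hR0 : 0 < R N := lt_of_lt_of_le (by positivity) hN
    have n1 : ∀ n : ℤ, |(n:ℝ)| ≠ R N := by
      intro n h
      have h1 := hR1 N
      rw [← h, ← Int.cast_abs, mul_comm, Real.sin_int_mul_pi] at h1
      norm_num at h1
    have n2 : ∀ n : ℤ, |(n / (1 + 2 * x) : ℝ)| ≠ R N := by
      intro n h
      have h1 := hR2 N
      have : sin (π * (1 + 2 * x) * R N) = 0 := by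
        rw [← h]
        rcases abs_cases (n / (1 + 2 * x) : ℝ) with h | h <;> rw [h.1]
        · have : π * (1 + 2 * x) * (n / (1 + 2 * x)) = n * π := by field_simp
          rw [this, Real.sin_int_mul_pi]
        · have : π * (1 + 2 * x) * -(n / (1 + 2 * x)) = -(n * π) := by field_simp
          rw [this, Real.sin_neg, Real.sin_int_mul_pi, neg_zero]
      rw [this] at h1
      norm_num at h1
    have hres := circle_res hx hR0 n1 n2 (I N) (J N)
      (fun n => by rw [hmem]; exact ⟨fun h => lt_of_le_of_ne h (n1 n), le_of_lt⟩)
      (fun n => by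
        rw [hmem]
        have : |(n:ℝ)| ≤ R N * |1 + 2 * x| ↔ |(n / (1 + 2 * x) : ℝ)| ≤ R N := by
          rw [abs_div, div_le_iff₀ hqpos]
        rw [this]; exact ⟨fun h => lt_of_le_of_ne h (n2 n), le_of_lt⟩)
    change _ = 2 * π * Complex.I * ((T N : ℝ) : ℂ) at hres
    have hb := circleIntegral.norm_integral_le_of_norm_le_const (f := FF x (1 + 2 * x)) (c := 0) (R := R N)
      (C := 16 * exp (π * |x|) / R N ^ 2) hR0.le (fun z hz => FF_bound hq hN (hR1 N) (hR2 N) z (by simpa using hz))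
    rw [hres, norm_mul, Complex.norm_real] at hb
    have h2 : ‖(2 * π * Complex.I : ℂ)‖ = 2 * π := by
      simp [abs_of_pos pi_pos]
    rw [h2, mul_assoc (2 * π) (R N)] at hb
    have := le_of_mul_le_mul_left hb (by positivity)
    refine this.trans (le_of_eq ?_)
    field_simp
  have hfin := tendsto_nhds_unique hT1 hT2
  have hx0 : x ≠ 0 := hx.ne_zero
  have hpi := pi_ne_zero
  have hB' : B = x * π * (3 * j + 1) / 3 := by
    rw [hB, div_eq_div_iff (by positivity) (by norm_num)]
    linear_combination (9 * x * π) * hxj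
  rw [hB'] at hfin
  have h3 : x * S = x * ((3 * (j:ℝ) + 1) * π ^ 2 / 3) := by
    field_simp at hfin
    linear_combination (-1/6) * hfin
  exact mul_left_cancel₀ hx0 h3

theorem secant_zeta_two_at_sqrt (j : ℤ) (hj : j ≠ 0) :
    ∑' n : ℕ, 1 / Real.cos (π * (n + 1) * Real.sqrt (2 * j * (2 * j + 1))) / ((n : ℝ) + 1) ^ 2 =
      (3 * (j : ℝ) + 1) * π ^ 2 / 6 := by
  have hpos : 0 < 2 * j * (2 * j + 1) := by
    rcases lt_or_gt_of_ne hj with h | h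
    · exact mul_pos_of_neg_of_neg (by omega) (by omega)
    · positivity
  obtain ⟨D, hD⟩ := Int.eq_ofNat_of_zero_le hpos.le
  have hDR : (2 * (j:ℝ) * (2 * j + 1)) = D := by exact_mod_cast hD
  have hDsq : ¬ IsSquare D := by
    rintro ⟨m, hm⟩
    have h1 : 2 * j * (2 * j + 1) = (m:ℤ) * m := by rw [hD, hm]; push_cast; rfl
    have hm0 : (0:ℤ) ≤ m := by positivity
    rcases lt_or_gt_of_ne hj with h | h
    · have a1 : (m:ℤ) < -(2 * j) := by by_contra hc; push Not at hc; nlinarith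
      have a2 : -(2 * j + 1) < (m:ℤ) := by by_contra hc; push Not at hc; nlinarith
      omega
    · have a1 : 2 * j < (m:ℤ) := by by_contra hc; push Not at hc; nlinarith
      have a2 : (m:ℤ) < 2 * j + 1 := by by_contra hc; push Not at hc; nlinarith
      omega
  have hirr : Irrational √(D:ℝ) := by rw [irrational_sqrt_natCast_iff]; exact hDsq
  have hsum := summ_nat D hDsq
  rw [hDR]
  set a := √(D:ℝ) with ha
  have ha0 : 0 ≤ a := Real.sqrt_nonneg _
  have ha2 : a ^ 2 = 2 * j * (2 * j + 1) := by rw [hDR]; exact Real.sq_sqrt (by positivity)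
  obtain ⟨x, hx, hxj, hq, hcos⟩ : ∃ x : ℝ, Irrational x ∧ x ^ 2 = 4 * j * x + 2 * j ∧ 1 ≤ |1 + 2 * x| ∧
      ∀ n : ℤ, cos (π * n * x) = cos (π * n * a) := by
    rcases lt_or_gt_of_ne hj with h | h
    · have hjR : (j:ℝ) ≤ -1 := by exact_mod_cast (by omega : j ≤ -1)
      refine ⟨2 * j - a, ?_, by linear_combination ha2, ?_, ?_⟩
      · have := hirr.intCast_sub (2 * j); push_cast at this; exact this
      · rw [abs_of_nonpos (by linarith)]; linarith
      · intro n
        have : π * n * (2 * j - a) = -(π * n * a - ((j * n : ℤ):ℝ) * (2 * π)) := by push_cast; ring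
        rw [this, Real.cos_neg, Real.cos_sub_int_mul_two_pi]
    · have hjR : (1:ℝ) ≤ j := by exact_mod_cast (by omega : 1 ≤ j)
      refine ⟨2 * j + a, ?_, by linear_combination ha2, ?_, ?_⟩
      · have := hirr.intCast_add (2 * j); push_cast at this; exact this
      · rw [abs_of_nonneg (by linarith)]; linarith
      · intro n
        have : π * n * (2 * j + a) = π * n * a + ((j * n : ℤ):ℝ) * (2 * π) := by push_cast; ring
        rw [this, Real.cos_add_int_mul_two_pi]
  have e1 : ∀ n : ℕ, sec2 x ((n:ℤ) + 1) = 1 / cos (π * (n + 1) * a) / ((n:ℝ) + 1) ^ 2 := by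
    intro n
    rw [sec2, hcos]; push_cast; rfl
  have e2 : ∀ n : ℕ, sec2 x (-((n:ℤ) + 1)) = 1 / cos (π * (n + 1) * a) / ((n:ℝ) + 1) ^ 2 := by
    intro n
    rw [sec2, hcos]; push_cast
    rw [mul_neg, neg_mul, Real.cos_neg, neg_sq]
  have e0 : sec2 x 0 = 0 := by simp [sec2]
  have s1 : Summable (fun n : ℕ => sec2 x n) := by
    rw [← summable_nat_add_iff 1]
    refine hsum.congr fun n => ?_
    rw [← e1]; push_cast; rfl
  have s2 : Summable (fun n : ℕ => sec2 x (-((n:ℤ) + 1))) := hsum.congr fun n => (e2 n).symm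
  have hs : Summable (sec2 x) := Summable.of_nat_of_neg_add_one s1 s2
  have hv := sum_value hx hxj hq hs
  rw [tsum_of_nat_of_neg_add_one s1 s2, s1.tsum_eq_zero_add] at hv
  simp only [e2, Nat.cast_add, Nat.cast_one, e1, Nat.cast_zero, e0] at hv
  linarith
end
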